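/- arXiv:0709.0243 — 3 statements merged into one kernel-verified Lean document; each statement's English description precedes it below -/
import Mathlib

section
/- Let n ≥ 1, let I ⊂ ℝ^n be a bounded open rectangle with sides parallel to the coordinate axes, let 1 < p < ∞, δ > 1, and let q > q*(p,δ), where q*(p,δ) is the unique solution x > 1 of ((x/δ)^p − 1)/(x − 1) = p. If a weight w on I satisfies ⟨w^p⟩_J ≤ δ^p ⟨w⟩_J^p for every bounded open axis-parallel subrectangle J ⊂ I (i.e., w is in the strong class s-RH_p^δ(I)), then for every such subrectangle J, ⟨w⟩_J · ⟨w^{1−q'}⟩_J^{q−1} ≤ (1/q*(p,δ)) · ((q−1)/(q−q*(p,δ)))^{q−1}, the same constant as in the one-dimensional case, independent of n; and this constant is sharp. -/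
open MeasureTheory Set ENNReal

/-- The average of an `ℝ≥0∞`-valued function over the open axis-parallel rectangle
`∏ (a i, b i)`. -/
noncomputable def rectAvg {n : ℕ} (w : (Fin n → ℝ) → ℝ≥0∞) (a b : Fin n → ℝ) : ℝ≥0∞ :=
  (∫⁻ x in Set.pi Set.univ fun i => Set.Ioo (a i) (b i), w x) /
    ENNReal.ofReal (∏ i, (b i - a i))

/-- `∏ (a i, b i)` is a (nonempty, bounded, open) axis-parallel subrectangle of
`∏ (A i, B i)`. -/
def SubRect {n : ℕ} (A B a b : Fin n → ℝ) : Prop :=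
  ∀ i, A i ≤ a i ∧ a i < b i ∧ b i ≤ B i

/-- `w ∈ s-RH_p^δ(I)` for the rectangle `I = ∏ (A i, B i)`: the reverse Hölder
inequality holds over every axis-parallel subrectangle. -/
def MemSRH {n : ℕ} (p δ : ℝ) (A B : Fin n → ℝ) (w : (Fin n → ℝ) → ℝ≥0∞) : Prop :=
  Measurable w ∧ (∫⁻ x in Set.pi Set.univ fun i => Set.Ioo (A i) (B i), w x) ≠ ⊤ ∧
    ∀ a b, SubRect A B a b →
      rectAvg (fun x => w x ^ p) a b ≤ ENNReal.ofReal δ ^ p * (rectAvg w a b) ^ p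


section

open Filter Topology

/-- The half-open box `∏ (a i, b i]`. -/
def ocBox {n : ℕ} (a b : Fin n → ℝ) : Set (Fin n → ℝ) :=
  univ.pi fun i => Ioc (a i) (b i)

lemma measurableSet_ocBox {n : ℕ} (a b : Fin n → ℝ) : MeasurableSet (ocBox a b) :=
  MeasurableSet.univ_pi fun _ => measurableSet_Ioc

lemma volume_ocBox_lt_top {n : ℕ} (a b : Fin n → ℝ) : volume (ocBox a b) < ⊤ := by
  rw [ocBox, Real.volume_pi_Ioc]
  exact ENNReal.prod_lt_top fun i _ => ENNReal.ofReal_lt_top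

lemma ocBox_subset {n : ℕ} {A B a b : Fin n → ℝ} (ha : A ≤ a) (hb : b ≤ B) :
    ocBox a b ⊆ ocBox A B :=
  Set.pi_mono fun i _ => Ioc_subset_Ioc (ha i) (hb i)

lemma ocBox_update_right {n : ℕ} {a b : Fin n → ℝ} {i : Fin n} {x : ℝ} (hx : x ≤ b i) :
    ocBox a (Function.update b i x) = ocBox a b ∩ {y | y i ≤ x} := by
  ext y
  simp only [ocBox, Set.mem_pi, mem_univ, forall_true_left, mem_Ioc, mem_inter_iff, mem_ofPred_eq]
  constructor
  · intro h
    have hi := h i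
    simp only [Function.update_self] at hi
    refine ⟨fun j => ?_, hi.2⟩
    by_cases hj : j = i
    · subst hj; exact ⟨hi.1, hi.2.trans hx⟩
    · simpa [Function.update_of_ne hj] using h j
  · rintro ⟨h, hi⟩ j
    by_cases hj : j = i
    · subst hj; simpa using ⟨(h j).1, hi⟩
    · simpa [Function.update_of_ne hj] using h j

lemma ocBox_update_left {n : ℕ} {a b : Fin n → ℝ} {i : Fin n} {x : ℝ} (hx : a i ≤ x) :
    ocBox (Function.update a i x) b = ocBox a b ∩ {y | y i ≤ x}ᶜ := by
  ext y
  simp only [ocBox, Set.mem_pi, mem_univ, forall_true_left, mem_Ioc, mem_inter_iff, mem_ofPred_eq,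
    mem_compl_iff, not_le]
  constructor
  · intro h
    have hi := h i
    simp only [Function.update_self] at hi
    refine ⟨fun j => ?_, hi.1⟩
    by_cases hj : j = i
    · subst hj; exact ⟨hx.trans_lt hi.1, hi.2⟩
    · simpa [Function.update_of_ne hj] using h j
  · rintro ⟨h, hi⟩ j
    by_cases hj : j = i
    · subst hj; simpa using ⟨hi, (h j).2⟩
    · simpa [Function.update_of_ne hj] using h j

lemma measurableSet_coord_le {n : ℕ} (i : Fin n) (x : ℝ) :
    MeasurableSet {y : Fin n → ℝ | y i ≤ x} :=
  measurableSet_le (measurable_pi_apply i) measurable_const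

lemma setIntegral_ocBox_split {n : ℕ} {a b : Fin n → ℝ} {i : Fin n} {x : ℝ}
    (hax : a i ≤ x) (hxb : x ≤ b i) {F : (Fin n → ℝ) → ℝ} (hF : IntegrableOn F (ocBox a b)) :
    ∫ y in ocBox a b, F y = (∫ y in ocBox a (Function.update b i x), F y) +
      ∫ y in ocBox (Function.update a i x) b, F y := by
  rw [ocBox_update_right hxb, ocBox_update_left hax, ← Set.sdiff_eq,
    integral_inter_add_sdiff (measurableSet_coord_le i x) hF]

lemma continuous_setIntegral_coord_le {n : ℕ} {S : Set (Fin n → ℝ)} (i : Fin n)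
    {F : (Fin n → ℝ) → ℝ} (hF : IntegrableOn F S) :
    Continuous fun x : ℝ => ∫ y in S ∩ {y | y i ≤ x}, F y := by
  have h : (fun x : ℝ => ∫ y in S ∩ {y | y i ≤ x}, F y) =
      fun x : ℝ => ∫ y in S, ({y | y i ≤ x} : Set (Fin n → ℝ)).indicator F y := by
    funext x
    rw [setIntegral_indicator (measurableSet_coord_le i x)]
  rw [h, continuous_iff_continuousAt]
  intro x₀
  refine continuousAt_of_dominated (bound := fun y => ‖F y‖) ?_ ?_ hF.norm ?_
  · exact Eventually.of_forall fun x =>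
      hF.aestronglyMeasurable.indicator (measurableSet_coord_le i x)
  · exact Eventually.of_forall fun x => Eventually.of_forall fun y => norm_indicator_le_norm_self _ _
  · have hnull : ∀ᵐ y : Fin n → ℝ, y i ≠ x₀ := by
      rw [ae_iff]
      simp only [ne_eq, not_not]
      exact Measure.pi_hyperplane (fun _ : Fin n => (volume : Measure ℝ)) i x₀
    filter_upwards [ae_restrict_of_ae hnull] with y hy
    rcases lt_or_gt_of_ne hy with hlt | hgt
    · refine (continuousAt_const (y := F y)).congr ?_
      filter_upwards [lt_mem_nhds hlt] with x hx
      rw [indicator_of_mem]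
      exact hx.le
    · refine (continuousAt_const (y := (0 : ℝ))).congr ?_
      filter_upwards [gt_mem_nhds hgt] with x hx
      rw [indicator_of_notMem]
      exact not_le.mpr hx

/-- Any box on which `F` has nonnegative integral can be cut orthogonally to a given axis into two
boxes on which `F` has nonnegative integral, in such a way that a piece thicker than one half of
the box carries zero integral. -/
lemma exists_cut {n : ℕ} {a b : Fin n → ℝ} (i : Fin n) (hab : a i ≤ b i)
    {F : (Fin n → ℝ) → ℝ} (hF : IntegrableOn F (ocBox a b)) (h0 : 0 ≤ ∫ y in ocBox a b, F y) :
    ∃ x, a i ≤ x ∧ x ≤ b i ∧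
      (0 ≤ ∫ y in ocBox a (Function.update b i x), F y) ∧
      (0 ≤ ∫ y in ocBox (Function.update a i x) b, F y) ∧
      (x ≤ (a i + b i) / 2 ∨ ∫ y in ocBox a (Function.update b i x), F y = 0) ∧
      ((a i + b i) / 2 ≤ x ∨ ∫ y in ocBox (Function.update a i x) b, F y = 0) := by
  set m := (a i + b i) / 2 with hm
  have ham : a i ≤ m := by rw [hm]; linarith
  have hmb : m ≤ b i := by rw [hm]; linarith
  set L : ℝ → ℝ := fun x => ∫ y in ocBox a b ∩ {y | y i ≤ x}, F y with hL
  have hLc : Continuous L := continuous_setIntegral_coord_le i hF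
  have hLeft : ∀ x, x ≤ b i → ∫ y in ocBox a (Function.update b i x), F y = L x := by
    intro x hx; rw [ocBox_update_right hx]
  have hRight : ∀ x, a i ≤ x → x ≤ b i →
      ∫ y in ocBox (Function.update a i x) b, F y = (∫ y in ocBox a b, F y) - L x := by
    intro x hx hx'
    rw [setIntegral_ocBox_split hx hx' hF, hLeft x hx']; ring
  have hLa : L (a i) = 0 := by
    rw [hL]
    have : ocBox a b ∩ {y | y i ≤ a i} = ∅ := by
      ext y
      simp only [mem_inter_iff, mem_ofPred_eq, mem_empty_iff_false, iff_false, not_and, not_le]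
      exact fun hy => (hy i (mem_univ i)).1
    simp [this]
  have hLb : L (b i) = ∫ y in ocBox a b, F y := by
    rw [← hLeft _ le_rfl, Function.update_eq_self]
  rcases lt_or_ge (L m) 0 with h1 | h1
  · obtain ⟨x, hx, hx0⟩ := intermediate_value_Icc hmb hLc.continuousOn ⟨h1.le, hLb ▸ h0⟩
    refine ⟨x, ham.trans hx.1, hx.2, ?_, ?_, Or.inr ?_, Or.inl hx.1⟩
    · rw [hLeft x hx.2, hx0]
    · rw [hRight x (ham.trans hx.1) hx.2, hx0]; simpa using h0
    · rw [hLeft x hx.2, hx0]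
  rcases lt_or_ge (L (b i)) (L m) with h2 | h2
  · obtain ⟨x, hx, hx0⟩ := intermediate_value_Icc ham hLc.continuousOn
      (show L (b i) ∈ Icc (L (a i)) (L m) from ⟨by rw [hLa, hLb]; exact h0, h2.le⟩)
    refine ⟨x, hx.1, hx.2.trans hmb, ?_, ?_, Or.inl hx.2, Or.inr ?_⟩
    · rw [hLeft x (hx.2.trans hmb), hx0, hLb]; exact h0
    · rw [hRight x hx.1 (hx.2.trans hmb), hx0, hLb]; simp
    · rw [hRight x hx.1 (hx.2.trans hmb), hx0, hLb]; simp
  · refine ⟨m, ham, hmb, ?_, ?_, Or.inl le_rfl, Or.inl le_rfl⟩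
    · rw [hLeft m hmb]; exact h1
    · rw [hRight m ham hmb, ← hLb]; linarith

lemma setIntegral_le_of_oscillation_le {X : Type*} [MeasurableSpace X] {μ : Measure X}
    {R : Set X} (hR : MeasurableSet R) (hRf : μ R < ⊤) {U f φ : X → ℝ} {C ε k : ℝ} (hC : 0 ≤ C)
    (hU : IntegrableOn U R μ) (hf : IntegrableOn f R μ) (hφ : IntegrableOn φ R μ)
    (hfU : ∀ x, f x ≤ C * max (-U x) 0) (hφk : ∀ x ∈ R, |φ x - k| ≤ ε)
    (h0 : 0 ≤ ∫ x in R, U x ∂μ) :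
    ∫ x in R, f x ∂μ ≤ ∫ x in R, C * (2 * |U x - φ x| + 2 * ε) ∂μ := by
  have hconst : ∀ r : ℝ, IntegrableOn (fun _ : X => r) R μ := fun r =>
    integrableOn_const hRf.ne
  have hd : IntegrableOn (fun x => |U x - φ x|) R μ := (hU.sub hφ).abs
  have hd0 : 0 ≤ ∫ x in R, |U x - φ x| ∂μ := integral_nonneg fun x => abs_nonneg _
  have hde : IntegrableOn (fun x => |U x - φ x| + 2 * ε) R μ := hd.add (hconst _)
  have key : ∫ _ in R, max (-(k + ε)) 0 ∂μ ≤ ∫ x in R, |U x - φ x| ∂μ := by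
    rcases le_total (-(k + ε)) 0 with hk | hk
    · rw [max_eq_right hk]; simpa using hd0
    · rw [max_eq_left hk]
      have : ∫ x in R, (-(k + ε)) ∂μ ≤ ∫ x in R, (|U x - φ x| - U x) ∂μ := by
        refine setIntegral_mono_on (hconst _) (hd.sub hU) hR fun x hx => ?_
        have h1 := (abs_le.mp (hφk x hx)).2
        have h2 := le_abs_self (U x - φ x)
        linarith
      rw [integral_sub hd hU] at this
      linarith
  calc ∫ x in R, f x ∂μ
      ≤ ∫ x in R, C * (max (-(k + ε)) 0 + (|U x - φ x| + 2 * ε)) ∂μ := by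
        refine setIntegral_mono_on hf
          (((hconst _).add (hd.add (hconst _))).const_mul C) hR fun x hx => ?_
        refine (hfU x).trans (mul_le_mul_of_nonneg_left ?_ hC)
        have h1 := abs_le.mp (hφk x hx)
        have h2 := neg_le_abs (U x - φ x)
        have h3 := le_max_left (-(k + ε)) 0
        have h4 := le_max_right (-(k + ε)) 0
        have h5 := abs_nonneg (U x - φ x)
        have hε : 0 ≤ ε := (abs_nonneg _).trans (hφk x hx)
        apply max_le <;> linarith
    _ = C * ((∫ _ in R, max (-(k + ε)) 0 ∂μ) +
          ((∫ x in R, |U x - φ x| ∂μ) + ∫ _ in R, 2 * ε ∂μ)) := by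
        rw [integral_const_mul, integral_add (hconst _) hde,
          integral_add hd (hconst _)]
    _ ≤ C * (2 * (∫ x in R, |U x - φ x| ∂μ) + ∫ _ in R, 2 * ε ∂μ) := by
        refine mul_le_mul_of_nonneg_left ?_ hC
        linarith
    _ = ∫ x in R, C * (2 * |U x - φ x| + 2 * ε) ∂μ := by
        rw [integral_const_mul C fun x => 2 * |U x - φ x| + 2 * ε,
          integral_add (hd.const_mul 2) (hconst _), integral_const_mul 2 fun x => |U x - φ x|]

/-- A form of the rising sun lemma for rectangles: an integral inequality known on the
subrectangles over which `U` has zero integral extends to those over which `U` has nonnegative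
integral. -/
lemma setIntegral_ocBox_nonpos {n : ℕ} {A B : Fin n → ℝ} (hAB : A ≤ B)
    {U f : (Fin n → ℝ) → ℝ} {C : ℝ} (hC : 0 ≤ C)
    (hU : IntegrableOn U (ocBox A B)) (hf : IntegrableOn f (ocBox A B))
    (hfU : ∀ x, f x ≤ C * max (-U x) 0)
    (H : ∀ a b, A ≤ a → a ≤ b → b ≤ B → ∫ x in ocBox a b, U x = 0 → ∫ x in ocBox a b, f x ≤ 0)
    (h0 : 0 ≤ ∫ x in ocBox A B, U x) : ∫ x in ocBox A B, f x ≤ 0 := by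
  have hfin := volume_ocBox_lt_top A B
  suffices hs : ∀ ε : ℝ, 0 < ε →
      ∫ x in ocBox A B, f x ≤ (C * (2 + 2 * volume.real (ocBox A B))) * ε by
    have hlim : Tendsto (fun ε : ℝ => (C * (2 + 2 * volume.real (ocBox A B))) * ε)
        (𝓝[>] 0) (𝓝 0) := by
      have : Tendsto (fun ε : ℝ => (C * (2 + 2 * volume.real (ocBox A B))) * ε)
        (𝓝 0) (𝓝 ((C * (2 + 2 * volume.real (ocBox A B))) * 0)) :=
        (continuous_const.mul continuous_id).tendsto 0
      rw [mul_zero] at this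
      exact this.mono_left nhdsWithin_le_nhds
    exact ge_of_tendsto hlim (eventually_nhdsWithin_of_forall fun ε hε => hs ε hε)
  intro ε hε
  obtain ⟨φ, hφs, hφε, hφc, hφi⟩ :=
    Integrable.exists_hasCompactSupport_integral_sub_le (μ := volume.restrict (ocBox A B)) hU hε
  have hφu := hφs.uniformContinuous_of_continuous hφc
  obtain ⟨η, hη, hφη⟩ := Metric.uniformContinuous_iff.mp hφu ε hε
  set e : (Fin n → ℝ) → ℝ := fun x => C * (2 * |U x - φ x| + 2 * ε) with he
  have hd : IntegrableOn (fun x => |U x - φ x|) (ocBox A B) := (hU.sub hφi).abs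
  have hei : IntegrableOn e (ocBox A B) :=
    ((hd.const_mul 2).add (integrableOn_const hfin.ne)).const_mul C
  have he0 : ∀ x, 0 ≤ e x := fun x => by positivity
  have main : ∀ N : ℕ, ∀ (m : Fin n → ℕ) (a b : Fin n → ℝ), ∑ i, m i = N → A ≤ a → a ≤ b →
      b ≤ B → (∀ i, b i - a i ≤ η / 2 * 2 ^ m i) → 0 ≤ ∫ x in ocBox a b, U x →
      ∫ x in ocBox a b, f x ≤ ∫ x in ocBox a b, e x := by
    intro N
    induction N with
    | zero =>
      intro m a b hm ha hab hb hside hU0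
      have hsub := ocBox_subset ha hb
      have hm0 : ∀ i, m i = 0 := fun i => by
        have := (Finset.sum_eq_zero_iff.mp hm) i (Finset.mem_univ i)
        exact this
      rcases (ocBox a b).eq_empty_or_nonempty with hem | ⟨x₀, hx₀⟩
      · simp [hem]
      · refine setIntegral_le_of_oscillation_le (k := φ x₀) (measurableSet_ocBox a b)
          (volume_ocBox_lt_top a b) hC (hU.mono_set hsub) (hf.mono_set hsub)
          (IntegrableOn.mono_set hφi hsub) hfU (fun x hx => ?_) hU0
        have hdist : dist x x₀ < η := by
          refine lt_of_le_of_lt ((dist_pi_le_iff (by positivity)).mpr fun i => ?_) (half_lt_self hη)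
          have h1 := hx i (mem_univ i)
          have h2 := hx₀ i (mem_univ i)
          have h3 := hside i
          rw [hm0 i, pow_zero, mul_one] at h3
          rw [Real.dist_eq, abs_le]
          constructor <;> linarith [h1.1, h1.2, h2.1, h2.2]
        exact (hφη hdist).le
    | succ N ih =>
      intro m a b hm ha hab hb hside hU0
      have hsub := ocBox_subset ha hb
      obtain ⟨i, hi⟩ : ∃ i, m i ≠ 0 := by
        by_contra hcon
        push Not at hcon
        simp [hcon] at hm
      obtain ⟨k, hk⟩ := Nat.exists_eq_succ_of_ne_zero hi
      obtain ⟨x, hax, hxb, hl, hr, hl', hr'⟩ := exists_cut i (hab i) (hU.mono_set hsub) hU0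
      have hm' : ∑ j, Function.update m i k j = N := by
        have h1 := Finset.sum_update_of_mem (Finset.mem_univ i) m k
        have h2 := Finset.add_sum_erase Finset.univ m (Finset.mem_univ i)
        rw [Finset.sdiff_singleton_eq_erase] at h1
        omega
      have hsi := hside i
      rw [hk, Nat.succ_eq_add_one, pow_succ] at hsi
      rw [setIntegral_ocBox_split hax hxb (hf.mono_set hsub),
        setIntegral_ocBox_split hax hxb (hei.mono_set hsub)]
      have hbu : Function.update b i x ≤ b := by
        rw [update_le_iff]; exact ⟨hxb, fun _ _ => le_rfl⟩
      have hau : a ≤ Function.update a i x := by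
        rw [le_update_iff]; exact ⟨hax, fun _ _ => le_rfl⟩
      have habu : a ≤ Function.update b i x := by
        rw [le_update_iff]; exact ⟨hax, fun j _ => hab j⟩
      have haub : Function.update a i x ≤ b := by
        rw [update_le_iff]; exact ⟨hxb, fun j _ => hab j⟩
      refine add_le_add ?_ ?_
      · rcases hl' with hx | hz
        · refine ih _ _ _ hm' ha habu (hbu.trans hb) (fun j => ?_) hl
          by_cases hj : j = i
          · subst hj; simp only [Function.update_self]; linarith
          · simpa [Function.update_of_ne hj] using hside j
        · exact (H _ _ ha habu (hbu.trans hb) hz).trans (integral_nonneg he0)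
      · rcases hr' with hx | hz
        · refine ih _ _ _ hm' (ha.trans hau) haub hb (fun j => ?_) hr
          by_cases hj : j = i
          · subst hj; simp only [Function.update_self]; linarith
          · simpa [Function.update_of_ne hj] using hside j
        · exact (H _ _ (ha.trans hau) haub hb hz).trans (integral_nonneg he0)
  have hex : ∀ i, ∃ m : ℕ, B i - A i ≤ η / 2 * 2 ^ m := fun i => by
    obtain ⟨m, hm⟩ := pow_unbounded_of_one_lt ((B i - A i) / (η / 2)) (one_lt_two (α := ℝ))
    refine ⟨m, ?_⟩
    rw [div_lt_iff₀ (by positivity)] at hm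
    linarith
  choose m hm using hex
  refine (main _ m A B rfl le_rfl hAB le_rfl hm h0).trans ?_
  have hdε : ∫ x in ocBox A B, |U x - φ x| ≤ ε := hφε
  have : ∫ x in ocBox A B, e x =
      C * (2 * (∫ x in ocBox A B, |U x - φ x|) + volume.real (ocBox A B) * (2 * ε)) := by
    rw [he, integral_const_mul, integral_add (hd.const_mul 2) (integrableOn_const hfin.ne),
      integral_const_mul, setIntegral_const, smul_eq_mul]
  rw [this, mul_assoc]
  refine mul_le_mul_of_nonneg_left ?_ hC
  linarith

end

/-- The integrand `v ^ p - D * (1 + p * (v - 1))` cut off at its larger root `c`. -/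
noncomputable def truncGap (p D c v : ℝ) : ℝ :=
  if v < c then v ^ p - D * (1 + p * (v - 1)) else 0

lemma measurable_truncGap (p D c : ℝ) : Measurable (truncGap p D c) := by
  unfold truncGap
  refine Measurable.ite measurableSet_Iio ?_ measurable_const
  fun_prop

section

variable {p D c : ℝ}

lemma rpow_tangent_le (hp : 1 < p) {c v : ℝ} (hc : 0 < c) (hv : 0 ≤ v) :
    c ^ p + p * (c ^ p / c) * (v - c) ≤ v ^ p := by
  have h := one_add_mul_self_le_rpow_one_add (s := v / c - 1)
    (by have := div_nonneg hv hc.le; linarith) hp.le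
  rw [add_sub_cancel, Real.div_rpow hv hc.le, le_div_iff₀ (Real.rpow_pos_of_pos hc p)] at h
  refine le_trans (le_of_eq ?_) h
  field_simp

lemma gap_nonneg (hp : 1 < p) (hD : 1 ≤ D) (hc : 1 < c) (hcD : c ^ p = D * (1 + p * (c - 1)))
    {v : ℝ} (hv : c ≤ v) : 0 ≤ v ^ p - D * (1 + p * (v - 1)) := by
  have hc0 : 0 < c := by linarith
  have h := rpow_tangent_le hp hc0 (hc0.le.trans hv)
  have h1 : D ≤ c ^ p / c := by
    rw [le_div_iff₀ hc0, hcD]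
    exact mul_le_mul_of_nonneg_left (by nlinarith) (by linarith)
  have h2 : p * D * (v - c) ≤ p * (c ^ p / c) * (v - c) :=
    mul_le_mul_of_nonneg_right (mul_le_mul_of_nonneg_left h1 (by linarith)) (by linarith)
  rw [hcD] at h h2
  linarith

lemma truncGap_le (hp : 1 < p) (hD : 1 ≤ D) (hc : 1 < c)
    (hcD : c ^ p = D * (1 + p * (c - 1))) (v : ℝ) :
    truncGap p D c v ≤ v ^ p - D * (1 + p * (v - 1)) := by
  unfold truncGap
  split_ifs with h
  · exact le_rfl
  · exact gap_nonneg hp hD hc hcD (not_lt.mp h)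

lemma truncGap_le_mul_max (hp : 1 < p) (hD : 1 ≤ D) (hc : 1 < c)
    (hcD : c ^ p = D * (1 + p * (c - 1))) {v : ℝ} (hv : 0 ≤ v) :
    truncGap p D c v ≤ D * (p - 1) * max (1 - v) 0 := by
  unfold truncGap
  split_ifs with h
  · rcases le_total v 1 with h1 | h1
    · rw [max_eq_left (by linarith)]
      have h2 : v ^ p ≤ v := by
        simpa using Real.rpow_le_rpow_of_exponent_ge_of_imp hv h1 hp.le
          (fun _ h0 => absurd h0 (by positivity))
      nlinarith
    · rw [max_eq_right (by linarith), mul_zero]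
      have hconv := (convexOn_rpow hp.le).2 (show (1 : ℝ) ∈ Ici 0 by simp)
        (show c ∈ Ici 0 from by simp; linarith)
        (show 0 ≤ (c - v) / (c - 1) from div_nonneg (by linarith) (by linarith))
        (show 0 ≤ (v - 1) / (c - 1) from div_nonneg (by linarith) (by linarith))
        (by rw [← add_div, div_eq_one_iff_eq (by linarith)]; ring)
      simp only [smul_eq_mul, mul_one, Real.one_rpow] at hconv
      have hv' : (c - v) / (c - 1) + (v - 1) / (c - 1) * c = v := by
        have : c - 1 ≠ 0 := by linarith
        field_simp
        ring
      rw [hv', hcD] at hconv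
      have h3 : (c - v) / (c - 1) ≤ (c - v) / (c - 1) * D :=
        le_mul_of_one_le_right (div_nonneg (by linarith) (by linarith)) hD
      have h4 : (c - v) / (c - 1) * D + (v - 1) / (c - 1) * (D * (1 + p * (c - 1))) =
          D * (1 + p * (v - 1)) := by
        have : c - 1 ≠ 0 := by linarith
        field_simp
        ring
      linarith
  · exact mul_nonneg (mul_nonneg (by linarith) (by linarith)) (le_max_right _ _)

lemma abs_truncGap_le (hp : 1 < p) (hD : 1 ≤ D) (hc : 1 < c) {v : ℝ} (hv : 0 ≤ v) :
    |truncGap p D c v| ≤ c ^ p + D * (1 + p * (c + 1)) := by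
  have hcp : 0 ≤ c ^ p := Real.rpow_nonneg (by linarith) p
  have hb : 0 ≤ D * (1 + p * (c + 1)) := by positivity
  unfold truncGap
  split_ifs with h
  · have h1 : v ^ p ≤ c ^ p := Real.rpow_le_rpow hv h.le (by linarith)
    have h2 : 0 ≤ v ^ p := Real.rpow_nonneg hv p
    have h3 : D * (1 + p * (v - 1)) ≤ D * (1 + p * (c + 1)) := by
      gcongr
      linarith
    have h4 : -(D * (1 + p * (c + 1))) ≤ D * (1 + p * (v - 1)) := by
      have : 0 ≤ 1 + p * (v - 1) + (1 + p * (c + 1)) := by nlinarith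
      nlinarith
    rw [abs_le]
    constructor <;> linarith
  · simpa using add_nonneg hcp hb

/-- A primitive in `t` of `((v / t) ^ p - D * (1 + p * (v / t - 1))) * t ^ (-s - 1)`. -/
noncomputable def gapPrimitive (p D s v t : ℝ) : ℝ :=
  -(v ^ p * t ^ (-p - s) / (p + s)) - D * (p - 1) * t ^ (-s) / s
    + D * p * v * t ^ (-s - 1) / (s + 1)

lemma hasDerivAt_gapPrimitive (hp : 1 < p) {s v t : ℝ} (hs : 0 < s) (hv : 0 ≤ v) (ht : 0 < t) :
    HasDerivAt (gapPrimitive p D s v)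
      (((v / t) ^ p - D * (1 + p * (v / t - 1))) * t ^ (-s - 1)) t := by
  have h1 := ((Real.hasDerivAt_rpow_const (p := -p - s) (Or.inl ht.ne')).const_mul
    (v ^ p)).div_const (p + s)
  have h2 := ((Real.hasDerivAt_rpow_const (p := -s) (Or.inl ht.ne')).const_mul
    (D * (p - 1))).div_const s
  have h3 := ((Real.hasDerivAt_rpow_const (p := -s - 1) (Or.inl ht.ne')).const_mul
    (D * p * v)).div_const (s + 1)
  refine ((h1.neg.sub h2).add h3).congr_deriv ?_
  have e1 : t ^ (-p - s - 1) = t ^ (-s - 1) / t ^ p := by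
    rw [← Real.rpow_sub ht]; congr 1; ring
  have e2 : t ^ (-s - 1 - 1) = t ^ (-s - 1) / t := by
    rw [Real.rpow_sub_one ht.ne' (-s - 1)]
  rw [e1, e2, Real.div_rpow hv ht.le]
  have : p + s ≠ 0 := by positivity
  have : s + 1 ≠ 0 := by positivity
  have : t ^ p ≠ 0 := (Real.rpow_pos_of_pos ht p).ne'
  field_simp
  ring

lemma continuousOn_gapPrimitive_deriv (hp : 1 < p) {s v : ℝ} {x y : ℝ} (hx : 0 < x) :
    ContinuousOn (fun t : ℝ => ((v / t) ^ p - D * (1 + p * (v / t - 1))) * t ^ (-s - 1))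
      (Icc x y) := by
  have ht : ∀ t ∈ Icc x y, t ≠ 0 := fun t ht => (hx.trans_le ht.1).ne'
  have h1 : ContinuousOn (fun t : ℝ => v / t) (Icc x y) :=
    continuousOn_const.div continuousOn_id ht
  refine ContinuousOn.mul (ContinuousOn.sub (h1.rpow_const fun t _ => Or.inr (by linarith)) ?_)
    (continuousOn_id.rpow_const fun t h => Or.inl (ht t h))
  fun_prop

lemma integral_gap (hp : 1 < p) {s v x y : ℝ} (hs : 0 < s) (hv : 0 ≤ v) (hx : 0 < x)
    (hxy : x ≤ y) :
    ∫ t in x..y, ((v / t) ^ p - D * (1 + p * (v / t - 1))) * t ^ (-s - 1) =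
      gapPrimitive p D s v y - gapPrimitive p D s v x := by
  refine intervalIntegral.integral_eq_sub_of_hasDerivAt (fun t ht => ?_) ?_
  · rw [uIcc_of_le hxy] at ht
    exact hasDerivAt_gapPrimitive hp hs hv (hx.trans_le ht.1)
  · refine ContinuousOn.intervalIntegrable ?_
    rw [uIcc_of_le hxy]
    exact continuousOn_gapPrimitive_deriv hp hx

lemma integral_truncGap_of_le (hp : 1 < p) (hc : 1 < c) {s v x y : ℝ} (hs : 0 < s) (hv : 0 ≤ v)
    (hx : 0 < x) (hxy : x ≤ y) (hvx : v / c ≤ x) :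
    ∫ t in x..y, truncGap p D c (v / t) * t ^ (-s - 1) =
      gapPrimitive p D s v y - gapPrimitive p D s v x := by
  rw [← integral_gap hp hs hv hx hxy]
  refine intervalIntegral.integral_congr_ae (Filter.Eventually.of_forall fun t ht => ?_)
  rw [uIoc_of_le hxy] at ht
  have hlt : v / t < c := by
    rw [div_lt_iff₀ (hx.trans ht.1), mul_comm, ← div_lt_iff₀ (by linarith)]
    exact hvx.trans_lt ht.1
  rw [truncGap, if_pos hlt]

lemma integral_truncGap_eq_zero (hc : 1 < c) {s v x y : ℝ} (hx : 0 < x) (hxy : x ≤ y)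
    (hvy : y ≤ v / c) : ∫ t in x..y, truncGap p D c (v / t) * t ^ (-s - 1) = 0 := by
  refine intervalIntegral.integral_zero_ae (Filter.Eventually.of_forall fun t ht => ?_)
  rw [uIoc_of_le hxy] at ht
  have hle : c ≤ v / t := by
    rw [le_div_iff₀ (hx.trans ht.1), mul_comm, ← le_div_iff₀ (by linarith)]
    exact ht.2.trans hvy
  rw [truncGap, if_neg hle.not_gt, zero_mul]

lemma gapPrimitive_mul (hcD : c ^ p = D * (1 + p * (c - 1))) (hp : 1 < p) (hc : 1 < c)
    {s t : ℝ} (hs : 0 < s) (ht : 0 < t) :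
    gapPrimitive p D s (c * t) t =
      -(D * (p * (p - 1) * (1 - (c - 1) * s) / ((p + s) * s * (s + 1))) * t ^ (-s)) := by
  have e1 : t ^ (-p - s) = t ^ (-s) / t ^ p := by rw [← Real.rpow_sub ht]; congr 1; ring
  have e2 : t ^ (-s - 1) = t ^ (-s) / t := by rw [Real.rpow_sub_one ht.ne']
  have : p + s ≠ 0 := by positivity
  have : s + 1 ≠ 0 := by positivity
  have : t ^ p ≠ 0 := (Real.rpow_pos_of_pos ht p).ne'
  rw [gapPrimitive, e1, e2, Real.mul_rpow (by linarith) ht.le, hcD]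
  field_simp
  ring

lemma gapPrimitive_le (hD : 1 ≤ D) (hcD : c ^ p = D * (1 + p * (c - 1))) (hp : 1 < p)
    (hc : 1 < c) {s v t : ℝ} (hs : 0 < s) (hcs : (c - 1) * s < 1) (hv : 0 ≤ v) (ht : 0 < t)
    (hvt : v / c ≤ t) :
    gapPrimitive p D s v t ≤ gapPrimitive p D s (c * t) t := by
  have hc0 : 0 < c := by linarith
  have hvt' : v ≤ c * t := by rwa [div_le_iff₀ hc0, mul_comm] at hvt
  have htp : 0 < t ^ p := Real.rpow_pos_of_pos ht p
  have hts : 0 < t ^ (-s) := Real.rpow_pos_of_pos ht _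
  have e1 : t ^ (-p - s) = t ^ (-s) / t ^ p := by rw [← Real.rpow_sub ht]; congr 1; ring
  have e2 : t ^ (-s - 1) = t ^ (-s) / t := by rw [Real.rpow_sub_one ht.ne']
  have htan := rpow_tangent_le hp (mul_pos hc0 ht) hv
  rw [Real.mul_rpow hc0.le ht.le] at htan
  have hslope : c ^ p / c / (p + s) ≤ D / (s + 1) := by
    rw [div_div, div_le_div_iff₀ (by positivity) (by positivity), hcD, mul_assoc]
    refine mul_le_mul_of_nonneg_left ?_ (by linarith)
    nlinarith
  have key : p * (c * t - v) * (c ^ p / c / (p + s)) ≤ p * (c * t - v) * (D / (s + 1)) :=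
    mul_le_mul_of_nonneg_left hslope (mul_nonneg (by linarith) (by linarith))
  have h1 : (c ^ p * t ^ p - v ^ p) / t ^ p / (p + s) ≤
      p * (c * t - v) * (c ^ p / c / (p + s)) / t := by
    have : (c ^ p * t ^ p - v ^ p) ≤ p * (c ^ p * t ^ p / (c * t)) * (c * t - v) := by
      linarith
    rw [div_div, div_le_iff₀ (by positivity)]
    refine this.trans (le_of_eq ?_)
    field_simp
  have h2 : p * (c * t - v) * (c ^ p / c / (p + s)) / t ≤ p * (c * t - v) * (D / (s + 1)) / t :=
    div_le_div_of_nonneg_right key ht.le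
  have h3 := mul_le_mul_of_nonneg_left (h1.trans h2) hts.le
  rw [← sub_nonneg] at h3 ⊢
  refine h3.trans (le_of_eq ?_)
  rw [gapPrimitive, gapPrimitive, e1, e2, Real.mul_rpow hc0.le ht.le]
  have : p + s ≠ 0 := by positivity
  have : s + 1 ≠ 0 := by positivity
  field_simp
  ring

lemma le_integral_truncGap (hD : 1 ≤ D) (hcD : c ^ p = D * (1 + p * (c - 1))) (hp : 1 < p)
    (hc : 1 < c) {s v ε M : ℝ} (hs : 0 < s) (hcs : (c - 1) * s < 1) (hv : 0 ≤ v) (hε : 0 < ε)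
    (hεM : ε ≤ M) :
    D * (p * (p - 1) * (1 - (c - 1) * s) / ((p + s) * s * (s + 1))) * (max (v / c) ε) ^ (-s)
      + gapPrimitive p D s v M ≤ ∫ t in ε..M, truncGap p D c (v / t) * t ^ (-s - 1) := by
  have hc0 : 0 < c := by linarith
  have hM : 0 < M := hε.trans_le hεM
  rcases le_total (v / c) ε with h1 | h1
  · rw [max_eq_right h1, integral_truncGap_of_le hp hc hs hv hε hεM h1]
    have h2 := gapPrimitive_le hD hcD hp hc hs hcs hv hε h1
    rw [gapPrimitive_mul hcD hp hc hs hε] at h2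
    linarith
  rw [max_eq_left h1]
  have hr : 0 < v / c := hε.trans_le h1
  have hpr := gapPrimitive_mul hcD hp hc hs hr
  rw [mul_div_cancel₀ v hc0.ne'] at hpr
  rcases le_total (v / c) M with h2 | h2
  · have hint : ∀ x y : ℝ, 0 < x → x ≤ y → IntervalIntegrable
        (fun t => truncGap p D c (v / t) * t ^ (-s - 1)) volume x y := by
      intro x y hx hxy
      rw [intervalIntegrable_iff_integrableOn_Ioc_of_le hxy]
      refine Integrable.of_bound (C := (c ^ p + D * (1 + p * (c + 1))) * x ^ (-s - 1)) ?_ ?_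
      · refine Measurable.aestronglyMeasurable ?_
        exact ((measurable_truncGap p D c).comp (measurable_const.div measurable_id)).mul
          (measurable_id.pow_const _)
      · filter_upwards [ae_restrict_mem measurableSet_Ioc] with t ht
        have ht0 := hx.trans ht.1
        rw [norm_mul, Real.norm_eq_abs, Real.norm_of_nonneg (Real.rpow_nonneg ht0.le _)]
        exact mul_le_mul (abs_truncGap_le hp hD hc (div_nonneg hv ht0.le))
          (Real.rpow_le_rpow_of_nonpos hx ht.1.le (by linarith)) (Real.rpow_nonneg ht0.le _)
          ((abs_nonneg _).trans (abs_truncGap_le hp hD hc hv))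
    rw [← intervalIntegral.integral_add_adjacent_intervals (hint _ _ hε h1) (hint _ _ hr h2),
      integral_truncGap_eq_zero hc hε h1 le_rfl, integral_truncGap_of_le hp hc hs hv hr h2 le_rfl]
    linarith
  · rw [integral_truncGap_eq_zero hc hε hεM h2]
    have h3 : 0 ≤ ∫ t in M..(v / c),
        ((v / t) ^ p - D * (1 + p * (v / t - 1))) * t ^ (-s - 1) := by
      refine intervalIntegral.integral_nonneg h2 fun t ht => ?_
      have ht0 : 0 < t := hM.trans_le ht.1
      refine mul_nonneg (gap_nonneg hp hD hc hcD ?_) (Real.rpow_nonneg ht0.le _)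
      rw [le_div_iff₀ ht0, mul_comm, ← le_div_iff₀ hc0]
      exact ht.2
    rw [integral_gap hp hs hv hM h2] at h3
    linarith

end

section

variable {p D c : ℝ}

lemma integrable_truncGap_div {X : Type*} [MeasurableSpace X] {μ : Measure X}
    [IsFiniteMeasure μ] (hp : 1 < p) (hD : 1 ≤ D) (hc : 1 < c) {u : X → ℝ} (hum : Measurable u)
    (hu0 : ∀ x, 0 ≤ u x) {t : ℝ} (ht : 0 < t) :
    Integrable (fun x => truncGap p D c (u x / t)) μ :=
  Integrable.of_bound
    ((measurable_truncGap p D c).comp (hum.div_const t)).aestronglyMeasurable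
    (c ^ p + D * (1 + p * (c + 1)))
    (Filter.Eventually.of_forall fun x => abs_truncGap_le hp hD hc (div_nonneg (hu0 x) ht.le))

lemma setIntegral_truncGap_nonpos {n : ℕ} (hp : 1 < p) (hD : 1 ≤ D) (hc : 1 < c)
    (hcD : c ^ p = D * (1 + p * (c - 1))) {A B : Fin n → ℝ} (hAB : A ≤ B)
    {u : (Fin n → ℝ) → ℝ} (hum : Measurable u) (hu0 : ∀ x, 0 ≤ u x)
    (hu : IntegrableOn u (ocBox A B)) (hup : IntegrableOn (fun x => u x ^ p) (ocBox A B))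
    (H : ∀ a b t, A ≤ a → a ≤ b → b ≤ B → 0 < t →
      ∫ x in ocBox a b, u x = t * volume.real (ocBox a b) →
      ∫ x in ocBox a b, u x ^ p ≤ D * t ^ p * volume.real (ocBox a b))
    {t : ℝ} (ht : 0 < t) (htu : t * volume.real (ocBox A B) ≤ ∫ x in ocBox A B, u x) :
    ∫ x in ocBox A B, truncGap p D c (u x / t) ≤ 0 := by
  have hfin : ∀ a b : Fin n → ℝ, volume (ocBox a b) ≠ ⊤ := fun a b => (volume_ocBox_lt_top a b).ne
  have hconst : ∀ (a b : Fin n → ℝ) (r : ℝ), IntegrableOn (fun _ => r) (ocBox a b) :=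
    fun a b r => integrableOn_const (hfin a b)
  have hf : ∀ a b : Fin n → ℝ,
      IntegrableOn (fun x => truncGap p D c (u x / t)) (ocBox a b) := fun a b => by
    have : IsFiniteMeasure (volume.restrict (ocBox a b)) :=
      isFiniteMeasure_restrict.mpr (hfin a b)
    exact integrable_truncGap_div hp hD hc hum hu0 ht
  refine setIntegral_ocBox_nonpos (U := fun x => u x - t) (C := D * (p - 1) / t) hAB
    (div_nonneg (mul_nonneg (by linarith) (by linarith)) ht.le) (hu.sub (hconst A B t)) (hf A B)
    (fun x => ?_) ?_ ?_
  · refine (truncGap_le_mul_max hp hD hc hcD (div_nonneg (hu0 x) ht.le)).trans (le_of_eq ?_)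
    have : max (-(u x - t)) 0 = t * max (1 - u x / t) 0 := by
      rw [mul_max_of_nonneg _ _ ht.le, mul_zero]
      congr 1
      field_simp
      ring
    rw [this]
    field_simp
  · intro a b ha hab hb h0
    have hsub := ocBox_subset ha hb
    have hu' := hu.mono_set hsub
    have hup' : IntegrableOn (fun x => u x ^ p) (ocBox a b) := IntegrableOn.mono_set hup hsub
    rw [integral_sub hu' (hconst a b t), setIntegral_const, smul_eq_mul, sub_eq_zero] at h0
    have hH := H a b t ha hab hb ht (by rw [h0, mul_comm])
    have htp : 0 < t ^ p := Real.rpow_pos_of_pos ht p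
    calc ∫ x in ocBox a b, truncGap p D c (u x / t)
        ≤ ∫ x in ocBox a b, ((t ^ p)⁻¹ * u x ^ p - (D * (1 - p) + D * p / t * u x)) := by
          refine setIntegral_mono_on (hf a b)
            ((hup'.const_mul _).sub ((hconst _ _ _).add (hu'.const_mul _)))
            (measurableSet_ocBox a b) fun x _ => ?_
          refine (truncGap_le hp hD hc hcD _).trans (le_of_eq ?_)
          rw [Real.div_rpow (hu0 x) ht.le]
          field_simp
          ring
      _ = (t ^ p)⁻¹ * (∫ x in ocBox a b, u x ^ p) -
            (volume.real (ocBox a b) * (D * (1 - p)) + D * p / t * ∫ x in ocBox a b, u x) := by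
          have hlin : IntegrableOn (fun x => D * (1 - p) + D * p / t * u x) (ocBox a b) :=
            (hconst _ _ _).add (hu'.const_mul _)
          rw [integral_sub (hup'.const_mul _) hlin, integral_add (hconst _ _ _) (hu'.const_mul _), setIntegral_const, smul_eq_mul,
            integral_const_mul, integral_const_mul]
      _ ≤ (t ^ p)⁻¹ * (D * t ^ p * volume.real (ocBox a b)) -
            (volume.real (ocBox a b) * (D * (1 - p)) + D * p / t * ∫ x in ocBox a b, u x) := by
          gcongr
      _ = 0 := by
          rw [h0]
          field_simp
          ring
  · rw [integral_sub hu (hconst A B t), setIntegral_const, smul_eq_mul]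
    linarith

lemma integral_max_rpow_neg_le {X : Type*} [MeasurableSpace X] {μ : Measure X}
    [IsFiniteMeasure μ] (hp : 1 < p) (hD : 1 ≤ D) (hc : 1 < c)
    (hcD : c ^ p = D * (1 + p * (c - 1))) {s : ℝ} (hs : 0 < s) (hcs : (c - 1) * s < 1)
    {u : X → ℝ} (hum : Measurable u) (hu0 : ∀ x, 0 ≤ u x)
    (hu : Integrable u μ) (hup : Integrable (fun x => u x ^ p) μ) {M ε : ℝ}
    (hε : 0 < ε) (hεM : ε ≤ M) (hMu : ∫ x, u x ∂μ = M * μ.real univ)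
    (hMp : ∫ x, u x ^ p ∂μ ≤ D * M ^ p * μ.real univ)
    (H : ∀ t, 0 < t → t ≤ M → ∫ x, truncGap p D c (u x / t) ∂μ ≤ 0) :
    ∫ x, (max (u x / c) ε) ^ (-s) ∂μ ≤ M ^ (-s) / (1 - (c - 1) * s) * μ.real univ := by
  have hM : 0 < M := hε.trans_le hεM
  have hc0 : 0 < c := by linarith
  have hFint : Integrable (Function.uncurry fun (x : X) (t : ℝ) =>
      truncGap p D c (u x / t) * t ^ (-s - 1)) (μ.prod (volume.restrict (Ioc ε M))) := by
    refine Integrable.of_bound (C := (c ^ p + D * (1 + p * (c + 1))) * ε ^ (-s - 1)) ?_ ?_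
    · refine Measurable.aestronglyMeasurable ?_
      exact ((measurable_truncGap p D c).comp
        ((hum.comp measurable_fst).div measurable_snd)).mul (measurable_snd.pow_const _)
    · have hae : ∀ᵐ z ∂(μ.prod (volume.restrict (Ioc ε M))), z.2 ∈ Ioc ε M :=
        Measure.quasiMeasurePreserving_snd.ae (ae_restrict_mem measurableSet_Ioc)
      filter_upwards [hae] with z hz
      have ht0 := hε.trans hz.1
      rw [Function.uncurry, norm_mul, Real.norm_eq_abs,
        Real.norm_of_nonneg (Real.rpow_nonneg ht0.le _)]
      have hb := abs_truncGap_le hp hD hc (div_nonneg (hu0 z.1) ht0.le)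
      exact mul_le_mul hb
        (Real.rpow_le_rpow_of_nonpos hε hz.1.le (by linarith)) (Real.rpow_nonneg ht0.le _)
        ((abs_nonneg _).trans hb)
  have hswap := integral_integral_swap hFint
  have hle0 : ∫ x, ∫ t in Ioc ε M, truncGap p D c (u x / t) * t ^ (-s - 1) ∂volume ∂μ ≤ 0 := by
    rw [hswap]
    refine setIntegral_nonpos measurableSet_Ioc fun t ht => ?_
    have ht0 := hε.trans ht.1
    rw [integral_mul_const]
    exact mul_nonpos_of_nonpos_of_nonneg (H t ht0 ht.2) (Real.rpow_nonneg ht0.le _)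
  set κ := D * (p * (p - 1) * (1 - (c - 1) * s) / ((p + s) * s * (s + 1))) with hκ
  have hκ0 : 0 < κ := by
    have : 0 < 1 - (c - 1) * s := by linarith
    have : 0 < p - 1 := by linarith
    positivity
  have hmaxi : Integrable (fun x => (max (u x / c) ε) ^ (-s)) μ := by
    refine Integrable.of_bound (C := ε ^ (-s)) ?_ (Filter.Eventually.of_forall fun x => ?_)
    · exact (((hum.div_const c).max measurable_const).pow_const _).aestronglyMeasurable
    · rw [Real.norm_of_nonneg (Real.rpow_nonneg (hε.le.trans (le_max_right _ _)) _)]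
      exact Real.rpow_le_rpow_of_nonpos hε (le_max_right _ _) (by linarith)
  have hprim : (fun x => gapPrimitive p D s (u x) M) = fun x =>
      (D * p * M ^ (-s - 1) / (s + 1)) * u x - ((M ^ (-p - s) / (p + s)) * u x ^ p +
        D * (p - 1) * M ^ (-s) / s) := by
    funext x
    rw [gapPrimitive]
    ring
  have hi1 := hu.const_mul (D * p * M ^ (-s - 1) / (s + 1))
  have hi2 := hup.const_mul (M ^ (-p - s) / (p + s))
  have hi3 : Integrable (fun _ : X => D * (p - 1) * M ^ (-s) / s) μ := integrable_const _
  have hi4 : Integrable (fun x => M ^ (-p - s) / (p + s) * u x ^ p +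
      D * (p - 1) * M ^ (-s) / s) μ := hi2.add hi3
  have hprimi : Integrable (fun x => gapPrimitive p D s (u x) M) μ := by
    rw [hprim]
    exact hi1.sub hi4
  have hlow : ∫ x, (κ * (max (u x / c) ε) ^ (-s) + gapPrimitive p D s (u x) M) ∂μ ≤ 0 := by
    refine le_trans (integral_mono ((hmaxi.const_mul κ).add hprimi) hFint.integral_prod_left
      fun x => ?_) hle0
    have := le_integral_truncGap hD hcD hp hc hs hcs (hu0 x) hε hεM
    rw [intervalIntegral.integral_of_le hεM] at this
    exact this
  rw [integral_add (hmaxi.const_mul κ) hprimi, integral_const_mul, hprim,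
    integral_sub hi1 hi4, integral_add hi2 hi3, integral_const_mul, integral_const_mul,
    integral_const, smul_eq_mul, hMu] at hlow
  have hMpp : 0 < M ^ p := Real.rpow_pos_of_pos hM p
  have e1 : M ^ (-p - s) = M ^ (-s) / M ^ p := by rw [← Real.rpow_sub hM]; congr 1; ring
  have e2 : M ^ (-s - 1) = M ^ (-s) / M := by rw [Real.rpow_sub_one hM.ne']
  have h1 : M ^ (-p - s) / (p + s) * ∫ x, u x ^ p ∂μ ≤
      M ^ (-p - s) / (p + s) * (D * M ^ p * μ.real univ) :=
    mul_le_mul_of_nonneg_left hMp (by positivity)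
  have h2 : κ * ∫ x, (max (u x / c) ε) ^ (-s) ∂μ ≤
      κ * (M ^ (-s) / (1 - (c - 1) * s) * μ.real univ) := by
    have h3 : κ * (M ^ (-s) / (1 - (c - 1) * s) * μ.real univ) =
        M ^ (-p - s) / (p + s) * (D * M ^ p * μ.real univ) +
          μ.real univ * (D * (p - 1) * M ^ (-s) / s) -
          D * p * M ^ (-s - 1) / (s + 1) * (M * μ.real univ) := by
      have : 1 - (c - 1) * s ≠ 0 := by linarith
      have : p + s ≠ 0 := by positivity
      have : s + 1 ≠ 0 := by positivity
      rw [e1, e2, hκ]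
      field_simp
      ring
    linarith
  exact le_of_mul_le_mul_left h2 hκ0

end

section

variable {n : ℕ} {A B a b : Fin n → ℝ}

lemma volume_ocBox (hab : ∀ i, a i ≤ b i) :
    volume (ocBox a b) = ENNReal.ofReal (∏ i, (b i - a i)) := by
  rw [ocBox, Real.volume_pi_Ioc, ENNReal.ofReal_prod_of_nonneg]
  exact fun i _ => sub_nonneg.mpr (hab i)

lemma volume_real_ocBox_pos (hab : ∀ i, a i < b i) : 0 < volume.real (ocBox a b) := by
  rw [measureReal_def, volume_ocBox fun i => (hab i).le,
    ENNReal.toReal_ofReal (Finset.prod_nonneg fun i _ => (sub_pos.mpr (hab i)).le)]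
  exact Finset.prod_pos fun i _ => sub_pos.mpr (hab i)

lemma volume_ocBox_ne_zero (hab : ∀ i, a i < b i) : volume (ocBox a b) ≠ 0 := fun h => by
  have := volume_real_ocBox_pos hab
  rw [measureReal_def, h] at this
  simp at this

lemma lintegral_ocBox (w : (Fin n → ℝ) → ℝ≥0∞) :
    ∫⁻ x in Set.pi Set.univ fun i => Set.Ioo (a i) (b i), w x = ∫⁻ x in ocBox a b, w x :=
  setLIntegral_congr
    (Measure.univ_pi_Ioo_ae_eq_Icc.trans Measure.univ_pi_Ioc_ae_eq_Icc.symm)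

lemma rectAvg_eq (hab : ∀ i, a i < b i) (w : (Fin n → ℝ) → ℝ≥0∞) :
    rectAvg w a b = (∫⁻ x in ocBox a b, w x) / volume (ocBox a b) := by
  rw [rectAvg, lintegral_ocBox, volume_ocBox fun i => (hab i).le]

lemma rectAvg_mul_volume (hab : ∀ i, a i < b i) (w : (Fin n → ℝ) → ℝ≥0∞) :
    rectAvg w a b * volume (ocBox a b) = ∫⁻ x in ocBox a b, w x := by
  rw [rectAvg_eq hab,
    ENNReal.div_mul_cancel (volume_ocBox_ne_zero hab) (volume_ocBox_lt_top a b).ne]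

lemma SubRect.lt (h : SubRect A B a b) (i : Fin n) : a i < b i := (h i).2.1

lemma SubRect.ocBox_subset (h : SubRect A B a b) : ocBox a b ⊆ ocBox A B :=
  _root_.ocBox_subset (fun i => (h i).1) fun i => (h i).2.2

lemma SubRect.trans {a' b' : Fin n → ℝ} (h : SubRect A B a b) (h' : SubRect a b a' b') :
    SubRect A B a' b' := fun i =>
  ⟨(h i).1.trans (h' i).1, (h' i).2.1, (h' i).2.2.trans (h i).2.2⟩

section MemSRH

variable {p δ : ℝ} {w : (Fin n → ℝ) → ℝ≥0∞}

lemma MemSRH.mono (hw : MemSRH p δ A B w) (h : SubRect A B a b) : MemSRH p δ a b w := by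
  refine ⟨hw.1, ?_, fun a' b' h' => hw.2.2 a' b' (h.trans h')⟩
  have h2 := hw.2.1
  rw [lintegral_ocBox] at h2 ⊢
  exact ((lintegral_mono_set h.ocBox_subset).trans_lt h2.lt_top).ne

lemma MemSRH.lintegral_ne_top (hw : MemSRH p δ A B w) : ∫⁻ x in ocBox A B, w x ≠ ⊤ := by
  rw [← lintegral_ocBox]; exact hw.2.1

lemma MemSRH.lintegral_rpow_le (hw : MemSRH p δ A B w) (h : SubRect A B a b) :
    ∫⁻ x in ocBox a b, w x ^ p ≤
      ENNReal.ofReal δ ^ p * rectAvg w a b ^ p * volume (ocBox a b) := by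
  rw [← rectAvg_mul_volume h.lt]
  exact mul_le_mul_left (hw.2.2 a b h) _

lemma MemSRH.rectAvg_ne_top (hw : MemSRH p δ A B w) (h : SubRect A B a b) :
    rectAvg w a b ≠ ⊤ := by
  rw [rectAvg_eq h.lt]
  exact ENNReal.div_ne_top (hw.mono h).lintegral_ne_top (volume_ocBox_ne_zero h.lt)

lemma MemSRH.setIntegral_rpow_le (hδ : 1 < δ) (hw : MemSRH p δ A B w) {t : ℝ}
    (hAa : A ≤ a) (hbB : b ≤ B) (ht : 0 < t)
    (h : ∫ x in ocBox a b, (w x).toReal = t * volume.real (ocBox a b)) :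
    ∫ x in ocBox a b, (w x).toReal ^ p ≤ δ ^ p * t ^ p * volume.real (ocBox a b) := by
  by_cases hlt : ∀ i, a i < b i
  · have hsub : SubRect A B a b := fun i => ⟨hAa i, hlt i, hbB i⟩
    have hfin := (hw.mono hsub).lintegral_ne_top
    have havg : rectAvg w a b = ENNReal.ofReal t := by
      rw [integral_toReal hw.1.aemeasurable (ae_lt_top hw.1 hfin)] at h
      rw [rectAvg_eq hlt, ← ENNReal.ofReal_toReal hfin, h, measureReal_def,
        ENNReal.ofReal_mul ht.le, ENNReal.ofReal_toReal (volume_ocBox_lt_top a b).ne,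
        ENNReal.mul_div_cancel_right (volume_ocBox_ne_zero hlt) (volume_ocBox_lt_top a b).ne]
    have hle := hw.lintegral_rpow_le hsub
    rw [havg, ENNReal.ofReal_rpow_of_pos (by linarith), ENNReal.ofReal_rpow_of_pos ht,
      ← ENNReal.ofReal_mul (by positivity)] at hle
    have htop : ENNReal.ofReal (δ ^ p * t ^ p) * volume (ocBox a b) ≠ ⊤ :=
      ENNReal.mul_ne_top ENNReal.ofReal_ne_top (volume_ocBox_lt_top a b).ne
    have hpm : Measurable fun x => w x ^ p := hw.1.pow_const p
    simp_rw [ENNReal.toReal_rpow]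
    rw [integral_toReal hpm.aemeasurable (ae_lt_top hpm (hle.trans_lt htop.lt_top).ne)]
    refine (ENNReal.toReal_mono htop hle).trans (le_of_eq ?_)
    rw [ENNReal.toReal_mul, ENNReal.toReal_ofReal (by positivity), measureReal_def]
  · push Not at hlt
    obtain ⟨i, hi⟩ := hlt
    have : ocBox a b = ∅ := by
      rw [ocBox, Set.univ_pi_eq_empty_iff]
      exact ⟨i, Set.Ioc_eq_empty hi.not_gt⟩
    simp [this]

lemma MemSRH.lintegral_rpow_neg_le (hp : 1 < p) (hδ : 1 < δ) {c : ℝ} (hc : 1 < c)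
    (hcδ : c ^ p = δ ^ p * (1 + p * (c - 1))) {s : ℝ} (hs : 0 < s) (hcs : (c - 1) * s < 1)
    (hAB : ∀ i, A i < B i) (hw : MemSRH p δ A B w) {M : ℝ} (hM : 0 < M)
    (havg : rectAvg w A B = ENNReal.ofReal M) :
    rectAvg (fun x => w x ^ (-s)) A B ≤
      ENNReal.ofReal ((c * M) ^ (-s) / (1 - (c - 1) * s)) := by
  have hsub : SubRect A B A B := fun i => ⟨le_rfl, hAB i, le_rfl⟩
  have hle : A ≤ B := fun i => (hAB i).le
  have hc0 : 0 < c := by linarith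
  have hfin := hw.lintegral_ne_top
  have hD : 1 ≤ δ ^ p := Real.one_le_rpow hδ.le (by linarith)
  have hVtop := (volume_ocBox_lt_top A B).ne
  have hfm : IsFiniteMeasure (volume.restrict (ocBox A B)) := isFiniteMeasure_restrict.mpr hVtop
  set u : (Fin n → ℝ) → ℝ := fun x => (w x).toReal with hu
  have hum : Measurable u := hw.1.ennreal_toReal
  have hu0 : ∀ x, 0 ≤ u x := fun x => ENNReal.toReal_nonneg
  have hui : IntegrableOn u (ocBox A B) :=
    integrable_toReal_of_lintegral_ne_top hw.1.aemeasurable hfin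
  have hwt : ∀ᵐ x ∂(volume.restrict (ocBox A B)), w x < ⊤ := ae_lt_top hw.1 hfin
  have hupi : IntegrableOn (fun x => u x ^ p) (ocBox A B) := by
    simp_rw [hu, ENNReal.toReal_rpow]
    refine integrable_toReal_of_lintegral_ne_top (hw.1.pow_const p).aemeasurable ?_
    refine ((hw.lintegral_rpow_le hsub).trans_lt ?_).ne
    exact ENNReal.mul_lt_top (ENNReal.mul_lt_top
      (ENNReal.rpow_lt_top_of_nonneg (by linarith) ENNReal.ofReal_ne_top)
      (ENNReal.rpow_lt_top_of_nonneg (by linarith) (hw.rectAvg_ne_top hsub)))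
      (volume_ocBox_lt_top A B)
  have hMu : ∫ x in ocBox A B, u x = M * volume.real (ocBox A B) := by
    rw [hu, integral_toReal hw.1.aemeasurable hwt, ← rectAvg_mul_volume hAB, havg,
      ENNReal.toReal_mul, ENNReal.toReal_ofReal hM.le, measureReal_def]
  have hMp := hw.setIntegral_rpow_le hδ le_rfl le_rfl hM hMu
  have hneg : ∀ t, 0 < t → t ≤ M →
      ∫ x in ocBox A B, truncGap p (δ ^ p) c (u x / t) ≤ 0 := fun t ht htM => by
    refine setIntegral_truncGap_nonpos hp hD hc hcδ hle hum hu0 hui hupi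
      (fun a b t ha _ hb ht h => hw.setIntegral_rpow_le hδ ha hb ht h) ht ?_
    rw [hMu]
    exact mul_le_mul_of_nonneg_right htM measureReal_nonneg
  set K := M ^ (-s) / (1 - (c - 1) * s) * volume.real (ocBox A B) with hK
  have hbound : ∀ k : ℕ, ∫⁻ x in ocBox A B, (ENNReal.ofReal (max (u x / c) (M / (k + 1)))) ^ (-s) ≤
      ENNReal.ofReal K := fun k => by
    have hk : (0 : ℝ) < k + 1 := by positivity
    have hε : 0 < M / (k + 1) := by positivity
    have hεM : M / (k + 1) ≤ M := div_le_self hM.le (by linarith [k.cast_nonneg (α := ℝ)])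
    have h := integral_max_rpow_neg_le (μ := volume.restrict (ocBox A B)) hp hD hc hcδ hs hcs hum
      hu0 hui hupi hε hεM (by rw [hMu]; simp) (by simpa using hMp) hneg
    have hpos : ∀ x, 0 < max (u x / c) (M / (k + 1)) := fun x => hε.trans_le (le_max_right _ _)
    have hint : Integrable (fun x => (max (u x / c) (M / (k + 1))) ^ (-s))
        (volume.restrict (ocBox A B)) := by
      refine Integrable.of_bound (C := (M / (k + 1)) ^ (-s)) ?_
        (Filter.Eventually.of_forall fun x => ?_)
      · exact (((hum.div_const c).max measurable_const).pow_const _).aestronglyMeasurable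
      · rw [Real.norm_of_nonneg (Real.rpow_nonneg (hpos x).le _)]
        exact Real.rpow_le_rpow_of_nonpos hε (le_max_right _ _) (by linarith)
    simp_rw [fun x => ENNReal.ofReal_rpow_of_pos (p := -s) (hpos x)]
    rw [← ofReal_integral_eq_lintegral_ofReal hint
      (Filter.Eventually.of_forall fun x => Real.rpow_nonneg (hpos x).le _)]
    refine ENNReal.ofReal_le_ofReal (h.trans (le_of_eq ?_))
    rw [hK, measureReal_restrict_apply_univ]
  have hlim : ∀ x, Filter.Tendsto
      (fun k : ℕ => (ENNReal.ofReal (max (u x / c) (M / (k + 1)))) ^ (-s)) Filter.atTop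
      (nhds ((ENNReal.ofReal (u x / c)) ^ (-s))) := fun x => by
    refine (ENNReal.continuous_rpow_const.tendsto _).comp
      ((ENNReal.continuous_ofReal.tendsto _).comp ?_)
    have h0 : Filter.Tendsto (fun k : ℕ => M / ((k : ℝ) + 1)) Filter.atTop (nhds 0) := by
      have := (tendsto_one_div_add_atTop_nhds_zero_nat (𝕜 := ℝ)).const_mul M
      simpa [div_eq_mul_inv] using this
    have := (tendsto_const_nhds (x := u x / c)).max h0
    rwa [max_eq_left (div_nonneg (hu0 x) hc0.le)] at this
  have hfatou : ∫⁻ x in ocBox A B, (ENNReal.ofReal (u x / c)) ^ (-s) ≤ ENNReal.ofReal K := by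
    calc ∫⁻ x in ocBox A B, (ENNReal.ofReal (u x / c)) ^ (-s)
        = ∫⁻ x in ocBox A B, Filter.liminf
            (fun k : ℕ => (ENNReal.ofReal (max (u x / c) (M / (k + 1)))) ^ (-s)) Filter.atTop :=
          lintegral_congr fun x => (hlim x).liminf_eq.symm
      _ ≤ Filter.liminf (fun k : ℕ => ∫⁻ x in ocBox A B,
            (ENNReal.ofReal (max (u x / c) (M / (k + 1)))) ^ (-s)) Filter.atTop :=
          lintegral_liminf_le fun k =>
            ((hum.div_const c).max measurable_const).ennreal_ofReal.pow_const _
      _ ≤ ENNReal.ofReal K := by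
          refine (Filter.liminf_le_liminf (Filter.Eventually.of_forall hbound)).trans (le_of_eq ?_)
          exact Filter.liminf_const _
  have hscale : ∫⁻ x in ocBox A B, w x ^ (-s) ≤
      ENNReal.ofReal (c ^ (-s)) * ENNReal.ofReal K := by
    calc ∫⁻ x in ocBox A B, w x ^ (-s)
        = ∫⁻ x in ocBox A B,
            ENNReal.ofReal (c ^ (-s)) * (ENNReal.ofReal (u x / c)) ^ (-s) := by
          refine lintegral_congr_ae ?_
          filter_upwards [hwt] with x hx
          rw [← ENNReal.ofReal_rpow_of_pos hc0,
            ← ENNReal.mul_rpow_of_ne_top ENNReal.ofReal_ne_top ENNReal.ofReal_ne_top,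
            ← ENNReal.ofReal_mul hc0.le, mul_div_cancel₀ _ hc0.ne', ENNReal.ofReal_toReal hx.ne]
      _ = ENNReal.ofReal (c ^ (-s)) * ∫⁻ x in ocBox A B, (ENNReal.ofReal (u x / c)) ^ (-s) :=
          lintegral_const_mul' _ _ ENNReal.ofReal_ne_top
      _ ≤ _ := by gcongr
  rw [rectAvg_eq hAB]
  refine ENNReal.div_le_of_le_mul (hscale.trans (le_of_eq ?_))
  have h1 : 0 < 1 - (c - 1) * s := by linarith
  rw [hK, measureReal_def, ENNReal.ofReal_mul (by positivity), ENNReal.ofReal_toReal hVtop,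
    ← mul_assoc, ← ENNReal.ofReal_mul (by positivity), Real.mul_rpow hc0.le hM.le, mul_div_assoc]

lemma MemSRH.rectAvg_mul_rectAvg_rpow_le (hp : 1 < p) (hδ : 1 < δ) {c q : ℝ} (hc : 1 < c)
    (hcδ : c ^ p = δ ^ p * (1 + p * (c - 1))) (hcq : c < q) (hw : MemSRH p δ A B w)
    (h : SubRect A B a b) :
    rectAvg w a b * (rectAvg (fun x => w x ^ (1 - q / (q - 1))) a b) ^ (q - 1)
        ≤ ENNReal.ofReal ((1 / c) * ((q - 1) / (q - c)) ^ (q - 1)) := by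
  rcases eq_or_ne (rectAvg w a b) 0 with h0 | h0
  · simp [h0]
  have hq1 : 0 < q - 1 := by linarith
  have hqc : 0 < q - c := by linarith
  have hexp : 1 - q / (q - 1) = -(1 / (q - 1)) := by
    field_simp
    ring
  have htop := hw.rectAvg_ne_top h
  have hM := ENNReal.toReal_pos h0 htop
  have hcs : (c - 1) * (1 / (q - 1)) < 1 := by
    rw [mul_one_div, div_lt_one hq1]
    linarith
  have hle := (hw.mono h).lintegral_rpow_neg_le hp hδ hc hcδ (one_div_pos.mpr hq1) hcs h.lt hM
    (ENNReal.ofReal_toReal htop).symm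
  rw [hexp]
  set M := (rectAvg w a b).toReal with hMdef
  have hcM : 0 < c * M := mul_pos (by linarith) hM
  have h1 : 1 - (c - 1) * (1 / (q - 1)) = (q - c) / (q - 1) := by
    field_simp
    ring
  rw [h1] at hle
  have hpow : ((c * M) ^ (-(1 / (q - 1))) / ((q - c) / (q - 1))) ^ (q - 1) =
      (c * M)⁻¹ * ((q - 1) / (q - c)) ^ (q - 1) := by
    rw [div_eq_mul_inv, inv_div, Real.mul_rpow (by positivity) (by positivity),
      ← Real.rpow_mul hcM.le, neg_mul, one_div_mul_cancel hq1.ne', Real.rpow_neg_one]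
  calc rectAvg w a b * (rectAvg (fun x => w x ^ (-(1 / (q - 1)))) a b) ^ (q - 1)
      ≤ ENNReal.ofReal M *
          ENNReal.ofReal ((c * M) ^ (-(1 / (q - 1))) / ((q - c) / (q - 1))) ^ (q - 1) := by
        rw [hMdef, ENNReal.ofReal_toReal htop, ← hMdef]
        gcongr
    _ = ENNReal.ofReal ((1 / c) * ((q - 1) / (q - c)) ^ (q - 1)) := by
        rw [ENNReal.ofReal_rpow_of_pos (by positivity), hpow, ← ENNReal.ofReal_mul hM.le]
        congr 1
        field_simp

end MemSRH

end

section

variable {n : ℕ} {A B a b : Fin n → ℝ}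

lemma lintegral_ocBox_coord (i : Fin n) {h : ℝ → ℝ≥0∞}
    (hh : Measurable h) :
    ∫⁻ x in ocBox a b, h (x i) =
      (∏ j ∈ Finset.univ.erase i, ENNReal.ofReal (b j - a j)) * ∫⁻ y in Ioc (a i) (b i), h y := by
  have hmap := Measure.pi_map_eval (fun j => (volume : Measure ℝ).restrict (Ioc (a j) (b j))) i
  rw [ocBox, volume_pi, Measure.restrict_pi_pi]
  calc ∫⁻ x, h (x i) ∂(Measure.pi fun j => (volume : Measure ℝ).restrict (Ioc (a j) (b j)))
      = ∫⁻ y, h y ∂((Measure.pi fun j => (volume : Measure ℝ).restrict (Ioc (a j) (b j))).map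
          (Function.eval i)) := (lintegral_map hh (measurable_pi_apply i)).symm
    _ = _ := by
        rw [hmap, lintegral_smul_measure, smul_eq_mul]
        simp

lemma rectAvg_coord (hab : ∀ i, a i < b i) (i : Fin n) {h : ℝ → ℝ≥0∞} (hh : Measurable h) :
    rectAvg (fun x => h (x i)) a b =
      (∫⁻ y in Ioc (a i) (b i), h y) / ENNReal.ofReal (b i - a i) := by
  have hpos : ∀ j, ENNReal.ofReal (b j - a j) ≠ 0 := fun j => by
    simpa using hab j
  rw [rectAvg_eq hab, lintegral_ocBox_coord i hh, ocBox, Real.volume_pi_Ioc,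
    ← Finset.mul_prod_erase Finset.univ _ (Finset.mem_univ i), mul_comm (ENNReal.ofReal _),
    ENNReal.mul_div_mul_left _ _ (Finset.prod_ne_zero_iff.mpr fun j _ => hpos j)
      (ENNReal.prod_ne_top fun j _ => ENNReal.ofReal_ne_top)]

lemma lintegral_ofReal_sub_rpow {x y z r : ℝ} (hzx : z ≤ x) (hxy : x ≤ y) (hr : -1 < r) :
    ∫⁻ t in Ioc x y, ENNReal.ofReal ((t - z) ^ r) =
      ENNReal.ofReal (((y - z) ^ (r + 1) - (x - z) ^ (r + 1)) / (r + 1)) := by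
  have hint : IntervalIntegrable (fun t : ℝ => (t - z) ^ r) volume x y := by
    have := (intervalIntegral.intervalIntegrable_rpow' (a := x - z) (b := y - z) hr).comp_sub_right z
    simpa using this
  rw [← ofReal_integral_eq_lintegral_ofReal
    ((intervalIntegrable_iff_integrableOn_Ioc_of_le hxy).mp hint),
    ← intervalIntegral.integral_of_le hxy,
    intervalIntegral.integral_comp_sub_right (fun t : ℝ => t ^ r) z, integral_rpow (Or.inl hr)]
  filter_upwards [ae_restrict_mem measurableSet_Ioc] with t ht
  exact Real.rpow_nonneg (by linarith [ht.1]) r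

/-- The average of the power weight `(x i - A i) ^ r`. -/
lemma rectAvg_rpow_coord (h : SubRect A B a b) (i : Fin n) {r : ℝ} (hr : -1 < r) :
    rectAvg (fun x => ENNReal.ofReal ((x i - A i) ^ r)) a b =
      ENNReal.ofReal (((b i - A i) ^ (r + 1) - (a i - A i) ^ (r + 1)) / (r + 1) / (b i - a i)) := by
  have hm : Measurable fun t : ℝ => ENNReal.ofReal ((t - A i) ^ r) :=
    ((measurable_id.sub_const _).pow_const _).ennreal_ofReal
  rw [rectAvg_coord h.lt i hm, lintegral_ofReal_sub_rpow (h i).1 (h i).2.1.le hr,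
    ENNReal.ofReal_div_of_pos (sub_pos.mpr (h i).2.1)]

lemma rectAvg_rpow_coord_rpow (h : SubRect A B a b) (i : Fin n) (r z : ℝ) :
    rectAvg (fun x => ENNReal.ofReal ((x i - A i) ^ r) ^ z) a b =
      rectAvg (fun x => ENNReal.ofReal ((x i - A i) ^ (r * z))) a b := by
  rw [rectAvg_eq h.lt, rectAvg_eq h.lt]
  congr 1
  refine setLIntegral_congr_fun (measurableSet_ocBox a b) fun x hx => ?_
  have hpos : 0 < x i - A i := by
    have := (hx i (mem_univ i)).1
    linarith [(h i).1]
  rw [ENNReal.ofReal_rpow_of_pos (Real.rpow_pos_of_pos hpos r), ← Real.rpow_mul hpos.le]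

/-- A two-term case of Popoviciu's reversed Hölder inequality. -/
lemma rpow_sub_mul_rpow_le {p α X Y : ℝ} (hp : 1 < p) (hα : 0 < α) (hX : 0 ≤ X) (hXY : X < Y) :
    (Y ^ (α * p + 1) - X ^ (α * p + 1)) * (Y - X) ^ (p - 1) ≤
      (Y ^ (α + 1) - X ^ (α + 1)) ^ p := by
  have hY : 0 < Y := hX.trans_lt hXY
  have hp0 : 0 < p := by linarith
  have hαp : 0 < α * p + 1 := by positivity
  have hpq : p.HolderConjugate (p / (p - 1)) := Real.HolderConjugate.conjExponent hp
  set U := Y ^ (α * p + 1) - X ^ (α * p + 1) with hU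
  have hU0 : 0 ≤ U := sub_nonneg.mpr (Real.rpow_le_rpow hX hXY.le hαp.le)
  have hV0 : 0 < Y - X := sub_pos.mpr hXY
  have hq : 1 / (p / (p - 1)) = (p - 1) / p := one_div_div _ _
  have hp1 : 0 < p - 1 := by linarith
  have hsimp : ∀ Z : ℝ, 0 ≤ Z → |Z ^ (1 / p)| ^ p = Z := fun Z hZ => by
    rw [abs_of_nonneg (Real.rpow_nonneg hZ _), ← Real.rpow_mul hZ, one_div_mul_cancel hp0.ne',
      Real.rpow_one]
  have hsimp' : ∀ Z : ℝ, 0 ≤ Z → |Z ^ ((p - 1) / p)| ^ (p / (p - 1)) = Z := fun Z hZ => by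
    rw [abs_of_nonneg (Real.rpow_nonneg hZ _), ← Real.rpow_mul hZ,
      div_mul_div_cancel₀ hp0.ne', div_self hp1.ne', Real.rpow_one]
  have hcomb : ∀ Z : ℝ, 0 ≤ Z →
      (Z ^ (α * p + 1)) ^ (1 / p) * Z ^ ((p - 1) / p) = Z ^ (α + 1) := fun Z hZ => by
    rw [← Real.rpow_mul hZ, ← Real.rpow_add_of_nonneg hZ (by positivity) (by positivity)]
    congr 1
    field_simp
    ring
  have hH := Real.inner_le_Lp_mul_Lq (Finset.univ : Finset (Fin 2))
    ![U ^ (1 / p), (X ^ (α * p + 1)) ^ (1 / p)] ![(Y - X) ^ ((p - 1) / p), X ^ ((p - 1) / p)] hpq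
  simp only [Fin.sum_univ_two, Matrix.cons_val_zero, Matrix.cons_val_one, hq] at hH
  rw [hsimp _ hU0, hsimp _ (Real.rpow_nonneg hX _), hsimp' _ hV0.le, hsimp' _ hX, hcomb X hX,
    sub_add_cancel, hU, sub_add_cancel, hcomb Y hY.le, ← hU] at hH
  have h1 : U ^ (1 / p) * (Y - X) ^ ((p - 1) / p) ≤ Y ^ (α + 1) - X ^ (α + 1) := by linarith
  have h2 := Real.rpow_le_rpow (by positivity) h1 hp0.le
  refine le_trans (le_of_eq ?_) h2
  rw [Real.mul_rpow (by positivity) (by positivity), ← Real.rpow_mul hU0, ← Real.rpow_mul hV0.le,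
    one_div_mul_cancel hp0.ne', div_mul_cancel₀ _ hp0.ne', Real.rpow_one]

lemma memSRH_rpow_coord (hAB : ∀ i, A i < B i) (i : Fin n) {p δ c : ℝ} (hp : 1 < p) (hδ : 1 < δ)
    (hc : 1 < c) (hcδ : c ^ p = δ ^ p * (1 + p * (c - 1))) :
    MemSRH p δ A B fun x => ENNReal.ofReal ((x i - A i) ^ (c - 1)) := by
  refine ⟨?_, ?_, fun a b h => ?_⟩
  · exact (((measurable_pi_apply i).sub_const _).pow_const _).ennreal_ofReal
  · rw [lintegral_ocBox, ← rectAvg_mul_volume hAB,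
      rectAvg_rpow_coord (fun i => ⟨le_rfl, hAB i, le_rfl⟩) i (by linarith)]
    exact ENNReal.mul_ne_top ENNReal.ofReal_ne_top (volume_ocBox_lt_top A B).ne
  · have hα : 0 < c - 1 := by linarith
    have hX : 0 ≤ a i - A i := sub_nonneg.mpr (h i).1
    have hXY : a i - A i < b i - A i := sub_lt_sub_right (h i).2.1 _
    have hW : 0 < b i - a i := sub_pos.mpr (h i).2.1
    have hp0 : 0 < p := by linarith
    have hαp : 0 < (c - 1) * p := mul_pos hα hp0
    rw [rectAvg_rpow_coord_rpow h, rectAvg_rpow_coord h i (by linarith),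
      rectAvg_rpow_coord h i (by linarith)]
    have hkey := rpow_sub_mul_rpow_le hp hα hX hXY
    have hd : 0 ≤ (b i - A i) ^ (c - 1 + 1) - (a i - A i) ^ (c - 1 + 1) :=
      sub_nonneg.mpr (Real.rpow_le_rpow hX hXY.le (by linarith))
    rw [ENNReal.ofReal_rpow_of_pos (by linarith),
      ENNReal.ofReal_rpow_of_nonneg (by positivity) hp0.le,
      ← ENNReal.ofReal_mul (by positivity)]
    refine ENNReal.ofReal_le_ofReal ?_
    rw [sub_sub_sub_cancel_right] at hkey
    have hWp : (b i - a i) ^ (p - 1) = (b i - a i) ^ p / (b i - a i) := Real.rpow_sub_one hW.ne' p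
    have hWpp : 0 < (b i - a i) ^ p := Real.rpow_pos_of_pos hW p
    rw [hWp] at hkey
    rw [Real.div_rpow (by positivity) hW.le, Real.div_rpow hd (by linarith), sub_add_cancel, hcδ]
    rw [sub_add_cancel] at hkey
    have hδp : 0 < δ ^ p := Real.rpow_pos_of_pos (by linarith) p
    have e1 : δ ^ p * (((b i - A i) ^ c - (a i - A i) ^ c) ^ p / (δ ^ p * (1 + p * (c - 1))) /
        (b i - a i) ^ p) = ((b i - A i) ^ c - (a i - A i) ^ c) ^ p / (((c - 1) * p + 1) *
        (b i - a i) ^ p) := by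
      have : 1 + p * (c - 1) ≠ 0 := by positivity
      have : (c - 1) * p + 1 ≠ 0 := by positivity
      field_simp
      ring
    rw [e1, le_div_iff₀ (by positivity)]
    refine le_trans (le_of_eq ?_) hkey
    have : (c - 1) * p + 1 ≠ 0 := by positivity
    field_simp

lemma rectAvg_mul_rectAvg_rpow_coord (hAB : ∀ i, A i < B i) (i : Fin n) {c q : ℝ} (hc : 1 < c)
    (hcq : c < q) :
    rectAvg (fun x => ENNReal.ofReal ((x i - A i) ^ (c - 1))) A B *
      (rectAvg (fun x => ENNReal.ofReal ((x i - A i) ^ (c - 1)) ^ (1 - q / (q - 1))) A B) ^ (q - 1)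
      = ENNReal.ofReal ((1 / c) * ((q - 1) / (q - c)) ^ (q - 1)) := by
  have hsub : SubRect A B A B := fun i => ⟨le_rfl, hAB i, le_rfl⟩
  have hY : 0 < B i - A i := sub_pos.mpr (hAB i)
  have hq1 : 0 < q - 1 := by linarith
  have hqc : 0 < q - c := by linarith
  have hexp : (c - 1) * (1 - q / (q - 1)) = (q - c) / (q - 1) - 1 := by
    field_simp
    ring
  have hr : 0 < (q - c) / (q - 1) := by positivity
  rw [rectAvg_rpow_coord_rpow hsub, hexp, rectAvg_rpow_coord hsub i (by linarith),
    rectAvg_rpow_coord hsub i (by linarith), sub_self, sub_add_cancel, sub_add_cancel,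
    Real.zero_rpow (by linarith), Real.zero_rpow hr.ne', sub_zero, sub_zero,
    ENNReal.ofReal_rpow_of_pos (by positivity), ← ENNReal.ofReal_mul (by positivity)]
  congr 1
  have hYr := Real.rpow_pos_of_pos hY ((q - c) / (q - 1))
  rw [Real.div_rpow (by positivity) hY.le, Real.div_rpow hYr.le hr.le, ← Real.rpow_mul hY.le,
    div_mul_cancel₀ _ hq1.ne', Real.div_rpow hqc.le hq1.le, Real.div_rpow hq1.le hqc.le]
  have e1 : (B i - A i) ^ (q - c) * (B i - A i) ^ c = (B i - A i) ^ (q - 1) * (B i - A i) := by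
    rw [← Real.rpow_add hY, ← Real.rpow_add_one hY.ne']
    congr 1
    ring
  have := Real.rpow_pos_of_pos hY (q - 1)
  have := Real.rpow_pos_of_pos hqc (q - 1)
  have := Real.rpow_pos_of_pos hq1 (q - 1)
  have hc0 : 0 < c := by linarith
  field_simp
  linarith

end

theorem statement10 (n : ℕ) (hn : 1 ≤ n) (A B : Fin n → ℝ) (hAB : ∀ i, A i < B i)
    (p δ qs q : ℝ) (hp : 1 < p) (hδ : 1 < δ)
    (hqs1 : 1 < qs) (hqs : ((qs / δ) ^ p - 1) / (qs - 1) = p) (hq : qs < q) :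
    (∀ w : (Fin n → ℝ) → ℝ≥0∞, MemSRH p δ A B w → ∀ a b, SubRect A B a b →
      rectAvg w a b * (rectAvg (fun x => w x ^ (1 - q / (q - 1))) a b) ^ (q - 1)
        ≤ ENNReal.ofReal ((1 / qs) * ((q - 1) / (q - qs)) ^ (q - 1))) ∧
    sSup { y : ℝ≥0∞ | ∃ w : (Fin n → ℝ) → ℝ≥0∞, MemSRH p δ A B w ∧
        ∃ a b, SubRect A B a b ∧
          y = rectAvg w a b * (rectAvg (fun x => w x ^ (1 - q / (q - 1))) a b) ^ (q - 1) }
      = ENNReal.ofReal ((1 / qs) * ((q - 1) / (q - qs)) ^ (q - 1)) := by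

  have hδ0 : 0 < δ := by linarith
  have hcδ : qs ^ p = δ ^ p * (1 + p * (qs - 1)) := by
    have hδp : δ ^ p ≠ 0 := (Real.rpow_pos_of_pos hδ0 p).ne'
    rw [div_eq_iff (by linarith), Real.div_rpow (by linarith) hδ0.le] at hqs
    field_simp at hqs
    linarith
  have hle : ∀ w : (Fin n → ℝ) → ℝ≥0∞, MemSRH p δ A B w → ∀ a b, SubRect A B a b →
      rectAvg w a b * (rectAvg (fun x => w x ^ (1 - q / (q - 1))) a b) ^ (q - 1)
        ≤ ENNReal.ofReal ((1 / qs) * ((q - 1) / (q - qs)) ^ (q - 1)) :=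
    fun w hw a b h => hw.rectAvg_mul_rectAvg_rpow_le hp hδ hqs1 hcδ hq h
  refine ⟨hle, le_antisymm (sSup_le ?_) (le_sSup ?_)⟩
  · rintro y ⟨w, hw, a, b, h, rfl⟩
    exact hle w hw a b h
  · let i : Fin n := ⟨0, hn⟩
    exact ⟨fun x => ENNReal.ofReal ((x i - A i) ^ (qs - 1)),
      memSRH_rpow_coord hAB i hp hδ hqs1 hcδ, A, B, fun j => ⟨le_rfl, hAB j, le_rfl⟩,
      (rectAvg_mul_rectAvg_rpow_coord hAB i hqs1 hq).symm⟩
end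

section
/- Let δ > 1, q > δ, and let I = [0,1]. For every point (x₁, x₂) with x₁ < x₂ ≤ δ x₁, the Bellman function for RH_∞^δ satisfies the exact formula: sup{ ⟨w^{1−q'}⟩_I : w ∈ RH_∞^δ(I), ⟨w⟩_I = x₁, ess sup_I w = x₂ } = x₂^{1−q'} · (q − δ x₁/x₂)/(q − δ). -/
open MeasureTheory Set ENNReal

/-- The average `⟨f⟩_{(a,b)}` of an `ℝ≥0∞`-valued function over an interval. -/
noncomputable def avgE (f : ℝ → ℝ≥0∞) (a b : ℝ) : ℝ≥0∞ :=
  (∫⁻ t in Set.Ioo a b, f t) / ENNReal.ofReal (b - a)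

/-- `w ∈ RH_∞^δ([A,B])`: on every subinterval, `ess sup w ≤ δ ⟨w⟩`. -/
def MemRHinf (δ A B : ℝ) (w : ℝ → ℝ≥0∞) : Prop :=
  Measurable w ∧ (∫⁻ t in Set.Ioo A B, w t) ≠ ⊤ ∧
    ∀ a b, A ≤ a → a < b → b ≤ B →
      essSup w (volume.restrict (Set.Ioo a b)) ≤ ENNReal.ofReal δ * avgE w a b

/-- An inequality between multiples of two measures on the connected components of an open set
holds on the whole set. -/
theorem mul_measure_le_of_components {μ ν : Measure ℝ} {c k : ℝ≥0∞} {O : Set ℝ} (hO : IsOpen O)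
    (h : ∀ x ∈ O, c * μ (connectedComponentIn O x) ≤ k * ν (connectedComponentIn O x)) :
    c * μ O ≤ k * ν O := by
  set S : Set (Set ℝ) := (connectedComponentIn O) '' O with hS
  have hopen : ∀ s ∈ S, IsOpen s := by
    rintro _ ⟨x, -, rfl⟩
    exact hO.connectedComponentIn
  have hdis : S.PairwiseDisjoint id := by
    rintro _ ⟨x, hx, rfl⟩ _ ⟨y, hy, rfl⟩ hne
    refine Set.disjoint_left.2 fun z hzx hzy => hne ?_
    rw [connectedComponentIn_eq hzx, connectedComponentIn_eq hzy]
  have hcount : S.Countable := hdis.countable_of_isOpen hopen (by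
    rintro _ ⟨x, hx, rfl⟩
    exact ⟨x, mem_connectedComponentIn hx⟩)
  have hU : O = ⋃ s ∈ S, id s := by
    ext z
    simp only [hS, mem_iUnion, id, mem_image, exists_prop]
    constructor
    · exact fun hz => ⟨_, ⟨z, hz, rfl⟩, mem_connectedComponentIn hz⟩
    · rintro ⟨_, ⟨x, -, rfl⟩, hz⟩
      exact connectedComponentIn_subset _ _ hz
  have key : ∀ m : Measure ℝ, m O = ∑' s : S, m s := fun m => by
    conv_lhs => rw [hU]
    exact measure_biUnion hcount hdis fun s hs => (hopen s hs).measurableSet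
  rw [key μ, key ν, ← ENNReal.tsum_mul_left, ← ENNReal.tsum_mul_left]
  refine ENNReal.tsum_le_tsum ?_
  rintro ⟨_, x, hx, rfl⟩
  exact h x hx

/-- The increasing rearrangement of a weight in `RH_∞^δ` satisfies the defining inequality on initial
intervals, written here in terms of sublevel sets. -/
theorem MemRHinf.mul_volume_lt_le {δ : ℝ} {w : ℝ → ℝ≥0∞} (hw : MemRHinf δ 0 1 w) {l : ℝ≥0∞}
    (hl : l < essSup w (volume.restrict (Ioo (0 : ℝ) 1))) :
    l * volume.restrict (Ioo (0 : ℝ) 1) {x | w x < l} ≤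
      ENNReal.ofReal δ * ∫⁻ x in {x | w x < l}, w x ∂(volume.restrict (Ioo (0 : ℝ) 1)) := by
  obtain ⟨hmeas, hfin, hRH⟩ := hw
  set μ : Measure ℝ := volume.restrict (Ioo (0 : ℝ) 1) with hμ
  set ν : Measure ℝ := μ.withDensity w with hν
  have hνfin : IsFiniteMeasure ν := isFiniteMeasure_withDensity hfin
  set E : Set ℝ := {x | w x < l} with hE
  have hEm : MeasurableSet E := measurableSet_lt hmeas measurable_const
  rw [← withDensity_apply _ hEm, ← hν]
  have hνμ : ν ≪ μ := withDensity_absolutelyContinuous _ _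
  -- the largest relatively open set on which `w < l` almost everywhere
  set U : Set ℝ := {x | ∃ a b, 0 ≤ a ∧ b ≤ 1 ∧ x ∈ Ioo a b ∧ μ (Ioo a b \ E) = 0} with hU
  have hUopen : IsOpen U := by
    rw [isOpen_iff_mem_nhds]
    rintro x ⟨a, b, ha, hb, hx, h0⟩
    exact Filter.mem_of_superset (Ioo_mem_nhds hx.1 hx.2) fun y hy => ⟨a, b, ha, hb, hy, h0⟩
  have hU0 : μ (U \ E) = 0 := by
    refine measure_null_of_locally_null _ ?_
    rintro x ⟨⟨a, b, ha, hb, hx, h0⟩, -⟩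
    exact ⟨Ioo a b ∩ (U \ E),
      Filter.inter_mem (mem_nhdsWithin_of_mem_nhds (Ioo_mem_nhds hx.1 hx.2)) self_mem_nhdsWithin,
      measure_mono_null (show _ ⊆ Ioo a b \ E from fun y hy => ⟨hy.1, hy.2.2⟩) h0⟩
  have interval : ∀ a b, 0 ≤ a → a < b → b ≤ 1 → μ (Ioo a b \ E) ≠ 0 →
      l * ENNReal.ofReal (b - a) ≤ ENNReal.ofReal δ * ν (Ioo a b) := by
    intro a b ha hab hb h0
    have hsub : Ioo a b ⊆ Ioo 0 1 := Ioo_subset_Ioo ha hb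
    have hle : l ≤ essSup w (volume.restrict (Ioo a b)) := by
      by_contra! hlt
      have := ae_lt_of_essSup_lt hlt
      refine h0 ?_
      rw [ae_iff, Measure.restrict_apply' measurableSet_Ioo] at this
      rw [hμ, Measure.restrict_apply' measurableSet_Ioo]
      refine measure_mono_null ?_ this
      rintro y ⟨⟨hy, hyE⟩, -⟩
      exact ⟨hyE, hy⟩
    have h1 := hle.trans (hRH a b ha hab hb)
    have hpos : 0 < b - a := sub_pos.2 hab
    have h2 : ν (Ioo a b) = ∫⁻ t in Ioo a b, w t := by
      rw [hν, withDensity_apply _ measurableSet_Ioo, hμ, Measure.restrict_restrict measurableSet_Ioo,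
        inter_eq_left.2 hsub]
    rw [h2]
    calc l * ENNReal.ofReal (b - a) ≤ (ENNReal.ofReal δ * avgE w a b) * ENNReal.ofReal (b - a) := by
          gcongr
      _ = _ := by
          rw [avgE, mul_assoc, ENNReal.div_mul_cancel]
          · simpa using hpos
          · simp
  refine ENNReal.le_of_forall_pos_le_add fun ε hε _ => ?_
  obtain ⟨e, he, hδe⟩ : ∃ e : ℝ≥0∞, e ≠ 0 ∧ ENNReal.ofReal δ * e ≤ ε := by
    refine ⟨ε / ENNReal.ofReal δ, ?_, ENNReal.mul_div_le⟩
    simp [hε.ne']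
  obtain ⟨O₁, hEO, hO₁, hνO⟩ := E.exists_isOpen_lt_add (measure_ne_top ν E) he
  set O : Set ℝ := (O₁ ∪ U) ∩ Ioo 0 1 with hOdef
  have hO : IsOpen O := (hO₁.union hUopen).inter isOpen_Ioo
  have hνO' : ν O ≤ ν E + e := by
    calc ν O ≤ ν (O₁ ∪ (U \ E)) := by
          refine measure_mono ?_
          rintro y ⟨hy | hy, -⟩
          · exact Or.inl hy
          · by_cases hyE : y ∈ E
            exacts [Or.inl (hEO hyE), Or.inr ⟨hy, hyE⟩]
      _ ≤ ν O₁ + ν (U \ E) := measure_union_le _ _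
      _ ≤ ν E + e := by rw [hνμ hU0, add_zero]; exact hνO.le
  have hμE : μ E ≤ volume O := by
    rw [hμ, Measure.restrict_apply' measurableSet_Ioo]
    exact measure_mono fun y hy => ⟨Or.inl (hEO hy.1), hy.2⟩
  have hcomp : ∀ x ∈ O, l * volume (connectedComponentIn O x) ≤
      ENNReal.ofReal δ * ν (connectedComponentIn O x) := by
    intro x hx
    set C := connectedComponentIn O x with hC
    have hxC : x ∈ C := mem_connectedComponentIn hx
    have hCO : C ⊆ O := connectedComponentIn_subset _ _
    have hC01 : C ⊆ Ioo 0 1 := fun y hy => (hCO hy).2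
    have hCpre : IsPreconnected C := isPreconnected_connectedComponentIn
    have hCopen : IsOpen C := hO.connectedComponentIn
    have hbb : BddBelow C := ⟨0, fun y hy => (hC01 hy).1.le⟩
    have hba : BddAbove C := ⟨1, fun y hy => (hC01 hy).2.le⟩
    set a := sInf C with ha
    set b := sSup C with hb
    have hCab : C = Ioo a b := by
      apply Subset.antisymm
      · have h1 : C ⊆ Icc a b := subset_Icc_csInf_csSup hbb hba
        calc C = interior C := hCopen.interior_eq.symm
          _ ⊆ interior (Icc a b) := interior_mono h1
          _ = Ioo a b := interior_Icc
      · exact IsConnected.Ioo_csInf_csSup_subset ⟨⟨x, hxC⟩, hCpre⟩ hbb hba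
    have hxab : x ∈ Ioo a b := hCab ▸ hxC
    have ha0 : 0 ≤ a := le_csInf ⟨x, hxC⟩ fun y hy => (hC01 hy).1.le
    have hb1 : b ≤ 1 := csSup_le ⟨x, hxC⟩ fun y hy => (hC01 hy).2.le
    have hstep : ∀ h : ℝ, 0 < h → l * ENNReal.ofReal (b - a) ≤
        ENNReal.ofReal δ * ν (Metric.cthickening h (Icc a b)) := by
      intro h hh
      set a' := max 0 (a - h) with ha'
      set b' := min 1 (b + h) with hb'
      have haa : a' ≤ a := max_le ha0 (by linarith)
      have hbb' : b ≤ b' := le_min hb1 (by linarith)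
      have hab' : a' < b' := by linarith [hxab.1, hxab.2]
      have hne : μ (Ioo a' b' \ E) ≠ 0 := by
        intro h0
        have hsubU : Ioo a' b' ⊆ O := fun y hy =>
          ⟨Or.inr ⟨a', b', le_max_left _ _, min_le_left _ _, hy, h0⟩,
            lt_of_le_of_lt (le_max_left _ _) hy.1, lt_of_lt_of_le hy.2 (min_le_left _ _)⟩
        have hsubC : Ioo a' b' ⊆ C := isPreconnected_Ioo.subset_connectedComponentIn
          ⟨by linarith [hxab.1], by linarith [hxab.2]⟩ hsubU
        rw [hCab] at hsubC
        obtain ⟨h1, h2⟩ := (Ioo_subset_Ioo_iff hab').1 hsubC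
        have ha'0 : a' = 0 := by
          rcases max_choice 0 (a - h) with h3 | h3
          · exact h3
          · exfalso; rw [← ha'] at h3; linarith
        have hb'1 : b' = 1 := by
          rcases min_choice 1 (b + h) with h3 | h3
          · exact h3
          · exfalso; rw [← hb'] at h3; linarith
        rw [ha'0, hb'1] at h0
        refine absurd hl (not_lt.2 (essSup_le_of_ae_le _ ?_))
        have : μ Eᶜ = 0 := by
          rw [hμ, Measure.restrict_apply' measurableSet_Ioo] at h0 ⊢
          exact measure_mono_null
            (show _ ⊆ (Ioo (0 : ℝ) 1 \ E) ∩ Ioo 0 1 from fun y hy => ⟨⟨hy.2, hy.1⟩, hy.2⟩) h0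
        filter_upwards [compl_mem_ae_iff.2 this] with y hy
        rw [compl_compl] at hy
        exact le_of_lt hy
      calc l * ENNReal.ofReal (b - a) ≤ l * ENNReal.ofReal (b' - a') := by gcongr
        _ ≤ ENNReal.ofReal δ * ν (Ioo a' b') :=
            interval a' b' (le_max_left _ _) hab' (min_le_left _ _) hne
        _ ≤ _ := by
            gcongr
            intro y hy
            have hab : a ≤ b := (hxab.1.trans hxab.2).le
            have h1 : a - h < y := lt_of_le_of_lt (le_max_right _ _) hy.1
            have h2 : y < b + h := lt_of_lt_of_le hy.2 (min_le_right _ _)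
            refine Metric.mem_cthickening_of_dist_le y (max a (min y b)) h _
              ⟨le_max_left _ _, max_le hab (min_le_right _ _)⟩ ?_
            rw [Real.dist_eq, abs_le]
            rcases le_total y b with h3 | h3 <;> rcases le_total a y with h4 | h4 <;>
              simp [h3, h4, hab] <;> (try constructor) <;> linarith
    have hlim : Filter.Tendsto (fun h => ENNReal.ofReal δ * ν (Metric.cthickening h (Icc a b)))
        (nhdsWithin 0 (Ioi 0)) (nhds (ENNReal.ofReal δ * ν (Icc a b))) :=
      (ENNReal.Tendsto.const_mul ((tendsto_measure_cthickening_of_isClosed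
        ⟨1, one_pos, measure_ne_top _ _⟩ isClosed_Icc).mono_left nhdsWithin_le_nhds)
        (Or.inr ENNReal.ofReal_ne_top))
    have hfinal : l * ENNReal.ofReal (b - a) ≤ ENNReal.ofReal δ * ν (Icc a b) :=
      ge_of_tendsto hlim (by filter_upwards [self_mem_nhdsWithin] with h hh using hstep h hh)
    have hIcc : ν (Icc a b) = ν (Ioo a b) :=
      measure_congr (hνμ.ae_le (Measure.absolutelyContinuous_of_le Measure.restrict_le_self
        |>.ae_le Ioo_ae_eq_Icc.symm))
    rwa [hCab, Real.volume_Ioo, ← hIcc]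
  calc l * μ E ≤ l * volume O := by gcongr
    _ ≤ ENNReal.ofReal δ * ν O := mul_measure_le_of_components hO hcomp
    _ ≤ ENNReal.ofReal δ * (ν E + e) := by gcongr
    _ ≤ ENNReal.ofReal δ * ν E + ε := by rw [mul_add]; gcongr

theorem lintegral_mul_setLIntegral_lt {α : Type*} [MeasurableSpace α] {μ : Measure α} [SFinite μ]
    {W : α → ℝ} (hW : Measurable W) {g : α → ℝ≥0∞} (hg : Measurable g) {f : ℝ → ℝ≥0∞}
    (hf : Measurable f) (a b : ℝ) :
    ∫⁻ l in Ioo a b, f l * ∫⁻ x in {x | W x < l}, g x ∂μ =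
      ∫⁻ x, g x * (∫⁻ l in Ioo (max a (W x)) b, f l) ∂μ := by
  have hms : MeasurableSet {z : ℝ × α | W z.2 < z.1} :=
    measurableSet_lt (hW.comp measurable_snd) measurable_fst
  have h1 : ∀ l, f l * ∫⁻ x in {x | W x < l}, g x ∂μ =
      ∫⁻ x, {z : ℝ × α | W z.2 < z.1}.indicator (fun z => f z.1 * g z.2) (l, x) ∂μ := by
    intro l
    rw [← lintegral_const_mul _ hg, ← lintegral_indicator (measurableSet_lt hW measurable_const)]
    rfl
  have h2 : ∀ x, g x * ∫⁻ l in Ioo (max a (W x)) b, f l =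
      ∫⁻ l in Ioo a b, {z : ℝ × α | W z.2 < z.1}.indicator (fun z => f z.1 * g z.2) (l, x) := by
    intro x
    have : Ioo (max a (W x)) b = Ioi (W x) ∩ Ioo a b := by
      ext l; simp only [mem_Ioo, max_lt_iff, mem_inter_iff, mem_Ioi]; tauto
    rw [this, ← Measure.restrict_restrict measurableSet_Ioi, mul_comm, ← lintegral_mul_const _ hf,
      ← lintegral_indicator measurableSet_Ioi]
    rfl
  simp_rw [h1, h2]
  refine lintegral_lintegral_swap (Measurable.aemeasurable ?_)
  exact ((hf.comp measurable_fst).mul (hg.comp measurable_snd)).indicator hms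

theorem setLIntegral_Ioo_rpow {s m M : ℝ} (hs : 0 < s) (hm : 0 < m) (hmM : m ≤ M) :
    ∫⁻ l in Ioo m M, ENNReal.ofReal (l ^ (-s - 1)) =
      ENNReal.ofReal ((m ^ (-s) - M ^ (-s)) / s) := by
  have h0 : (0 : ℝ) ∉ Set.uIcc m M := by
    rw [uIcc_of_le hmM]; exact fun h => absurd h.1 (not_le.2 hm)
  have hinteg : IntervalIntegrable (fun l : ℝ => l ^ (-s - 1)) volume m M :=
    intervalIntegral.intervalIntegrable_rpow (Or.inr h0)
  rw [Measure.restrict_congr_set Ioo_ae_eq_Ioc, ← ofReal_integral_eq_lintegral_ofReal,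
    ← intervalIntegral.integral_of_le hmM, integral_rpow (Or.inr ⟨by linarith, h0⟩)]
  · congr 1
    rw [sub_add_cancel, div_neg, ← neg_div, neg_sub]
  · rwa [intervalIntegrable_iff_integrableOn_Ioc_of_le hmM] at hinteg
  · filter_upwards [ae_restrict_mem measurableSet_Ioc] with l hl
    exact Real.rpow_nonneg (hm.trans hl.1).le _

/-- A bound on a truncated negative moment, from a bound on sublevel sets. -/
theorem integral_max_rpow_le {α : Type*} [MeasurableSpace α] {μ : Measure α}
    [IsProbabilityMeasure μ] {W : α → ℝ} (hW : Measurable W) {M p δ ε : ℝ} (hp : 0 < p)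
    (hδ : 0 ≤ δ) (hε : 0 < ε) (hεM : ε < M) (hW0 : ∀ᵐ x ∂μ, 0 ≤ W x) (hWM : ∀ᵐ x ∂μ, W x ≤ M)
    (h : ∀ l, 0 < l → l < M → ENNReal.ofReal l * μ {x | W x < l} ≤
      ENNReal.ofReal δ * ∫⁻ x in {x | W x < l}, ENNReal.ofReal (W x) ∂μ) :
    (∫ x, (max ε (W x)) ^ (-p) ∂μ) * (1 / p - δ / (p + 1)) ≤
      M ^ (-p) / p - δ / (p + 1) * M ^ (-p - 1) * ∫ x, W x ∂μ := by
  have hM : 0 < M := hε.trans hεM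
  have hmpos : ∀ x, 0 < max ε (W x) := fun x => lt_of_lt_of_le hε (le_max_left _ _)
  have hmM : ∀ᵐ x ∂μ, max ε (W x) ≤ M := hWM.mono fun x hx => max_le hεM.le hx
  have hmeas : ∀ r : ℝ, Measurable fun x => (max ε (W x)) ^ r := fun r => by fun_prop
  have hpow_le : ∀ s : ℝ, 0 < s → ∀ x, (max ε (W x)) ^ (-s) ≤ ε ^ (-s) := fun s hs x =>
    Real.rpow_le_rpow_of_nonpos hε (le_max_left _ _) (by linarith)
  have hpow_ge : ∀ s : ℝ, 0 < s → ∀ x, max ε (W x) ≤ M → M ^ (-s) ≤ (max ε (W x)) ^ (-s) :=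
    fun s hs x hx => Real.rpow_le_rpow_of_nonpos (hmpos x) hx (by linarith)
  have hinteg : ∀ s : ℝ, 0 < s → Integrable (fun x => (max ε (W x)) ^ (-s)) μ := fun s hs =>
    Integrable.of_bound (hmeas _).aestronglyMeasurable (ε ^ (-s)) (Filter.Eventually.of_forall
      fun x => by
        rw [Real.norm_of_nonneg (Real.rpow_nonneg (hmpos x).le _)]
        exact hpow_le s hs x)
  have hWint : Integrable W μ := Integrable.of_bound hW.aestronglyMeasurable M (by
    filter_upwards [hW0, hWM] with x h0 h1
    rwa [Real.norm_of_nonneg h0])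
  have hWpint : ∀ s : ℝ, 0 < s → Integrable (fun x => W x * (max ε (W x)) ^ (-s)) μ := fun s hs =>
    (hinteg s hs).bdd_mul (c := M) hW.aestronglyMeasurable (by
      filter_upwards [hW0, hWM] with x h0 h1
      rwa [Real.norm_of_nonneg h0])
  have hp1 : 0 < p + 1 := by linarith
  have key : ∫⁻ x, ENNReal.ofReal (((max ε (W x)) ^ (-p) - M ^ (-p)) / p) ∂μ ≤
      ENNReal.ofReal δ * ∫⁻ x, ENNReal.ofReal
        (W x * (((max ε (W x)) ^ (-(p + 1)) - M ^ (-(p + 1))) / (p + 1))) ∂μ := by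
    have e1 : ∫⁻ x, ENNReal.ofReal (((max ε (W x)) ^ (-p) - M ^ (-p)) / p) ∂μ =
        ∫⁻ l in Ioo ε M, ENNReal.ofReal (l ^ (-p - 1)) * ∫⁻ x in {x | W x < l}, 1 ∂μ := by
      rw [lintegral_mul_setLIntegral_lt hW measurable_const (by fun_prop)]
      refine lintegral_congr_ae ?_
      filter_upwards [hmM] with x hx
      rw [setLIntegral_Ioo_rpow hp (hmpos x) hx, one_mul]
    have e2 : ∫⁻ x, ENNReal.ofReal
        (W x * (((max ε (W x)) ^ (-(p + 1)) - M ^ (-(p + 1))) / (p + 1))) ∂μ =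
        ∫⁻ l in Ioo ε M, ENNReal.ofReal (l ^ (-(p + 1) - 1)) *
          ∫⁻ x in {x | W x < l}, ENNReal.ofReal (W x) ∂μ := by
      rw [lintegral_mul_setLIntegral_lt hW (by fun_prop) (by fun_prop)]
      refine lintegral_congr_ae ?_
      filter_upwards [hmM, hW0] with x hx h0
      rw [setLIntegral_Ioo_rpow hp1 (hmpos x) hx, ENNReal.ofReal_mul h0]
    rw [e1, e2, ← lintegral_const_mul' _ _ ENNReal.ofReal_ne_top]
    refine setLIntegral_mono' measurableSet_Ioo fun l hl => ?_
    have hl0 : 0 < l := hε.trans hl.1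
    have : l ^ (-p - 1) = l ^ (-(p + 1) - 1) * l := by
      rw [← Real.rpow_add_one hl0.ne']; congr 1; ring
    rw [this, ENNReal.ofReal_mul (Real.rpow_nonneg hl0.le _), setLIntegral_one, mul_assoc,
      mul_left_comm (ENNReal.ofReal δ)]
    exact mul_le_mul' le_rfl (h l hl0 hl.2)
  have hi1 : Integrable (fun x => ((max ε (W x)) ^ (-p) - M ^ (-p)) / p) μ :=
    ((hinteg p hp).sub (integrable_const _)).div_const _
  have hi2 : Integrable
      (fun x => W x * (((max ε (W x)) ^ (-(p + 1)) - M ^ (-(p + 1))) / (p + 1))) μ := by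
    have := ((hWpint (p + 1) hp1).sub (hWint.mul_const (M ^ (-(p + 1))))).div_const (p + 1)
    refine this.congr (Filter.Eventually.of_forall fun x => ?_)
    simp only [Pi.sub_apply]
    ring
  have hn1 : 0 ≤ᵐ[μ] fun x => ((max ε (W x)) ^ (-p) - M ^ (-p)) / p := by
    filter_upwards [hmM] with x hx
    exact div_nonneg (sub_nonneg.2 (hpow_ge p hp x hx)) hp.le
  have hn2 : 0 ≤ᵐ[μ]
      fun x => W x * (((max ε (W x)) ^ (-(p + 1)) - M ^ (-(p + 1))) / (p + 1)) := by
    filter_upwards [hmM, hW0] with x hx h0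
    exact mul_nonneg h0 (div_nonneg (sub_nonneg.2 (hpow_ge (p + 1) hp1 x hx)) hp1.le)
  rw [← ofReal_integral_eq_lintegral_ofReal hi1 hn1, ← ofReal_integral_eq_lintegral_ofReal hi2 hn2,
    ← ENNReal.ofReal_mul hδ, ENNReal.ofReal_le_ofReal_iff
      (mul_nonneg hδ (integral_nonneg_of_ae hn2))] at key
  have h3 : ∫ x, W x * (((max ε (W x)) ^ (-(p + 1)) - M ^ (-(p + 1))) / (p + 1)) ∂μ ≤
      ∫ x, ((max ε (W x)) ^ (-p) - W x * M ^ (-(p + 1))) / (p + 1) ∂μ := by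
    refine integral_mono hi2 (((hinteg p hp).sub (hWint.mul_const _)).div_const _) fun x => ?_
    have : (max ε (W x)) ^ (-p) = max ε (W x) * (max ε (W x)) ^ (-(p + 1)) := by
      rw [← Real.rpow_one_add' (hmpos x).le (by linarith)]; congr 1; ring
    simp only [this, ← mul_div_assoc]
    have := Real.rpow_nonneg (hmpos x).le (-(p + 1))
    have := le_max_right ε (W x)
    gcongr
    nlinarith
  rw [integral_div, integral_sub (hinteg p hp) (integrable_const _)] at key
  rw [integral_div, integral_sub (hinteg p hp) (hWint.mul_const _), integral_mul_const] at h3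
  simp only [integral_const, probReal_univ, smul_eq_mul, one_mul] at key
  have h4 := key.trans (mul_le_mul_of_nonneg_left h3 hδ)
  have h5 : (-p - 1 : ℝ) = -(p + 1) := by ring
  rw [h5]
  generalize (∫ x, (max ε (W x)) ^ (-p) ∂μ) = A at *
  generalize M ^ (-(p + 1)) = N at *
  have e1 : (A - M ^ (-p)) / p = A * (1 / p) - M ^ (-p) / p := by ring
  have e2 : δ * ((A - (∫ x, W x ∂μ) * N) / (p + 1)) =
    A * (δ / (p + 1)) - δ / (p + 1) * N * ∫ x, W x ∂μ := by ring
  rw [e1, e2] at h4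
  linarith

theorem avgE_zero_one (f : ℝ → ℝ≥0∞) : avgE f 0 1 = ∫⁻ t in Ioo (0 : ℝ) 1, f t := by
  simp [avgE]

/-- The upper bound for the Bellman function. -/
theorem MemRHinf.avgE_rpow_le {δ q x₁ x₂ : ℝ} (hδ : 1 < δ) (hq : δ < q) (hx1 : 0 < x₁)
    (h12 : x₁ < x₂) {w : ℝ → ℝ≥0∞} (hw : MemRHinf δ 0 1 w)
    (havg : avgE w 0 1 = ENNReal.ofReal x₁)
    (hsup : essSup w (volume.restrict (Ioo (0 : ℝ) 1)) = ENNReal.ofReal x₂) :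
    avgE (fun t => w t ^ (1 - q / (q - 1))) 0 1 ≤
      ENNReal.ofReal (x₂ ^ (1 - q / (q - 1)) * (q - δ * x₁ / x₂) / (q - δ)) := by
  have hx2 : 0 < x₂ := hx1.trans h12
  have hq1 : 0 < q - 1 := by linarith
  rw [avgE_zero_one] at *
  set μ : Measure ℝ := volume.restrict (Ioo (0 : ℝ) 1) with hμ
  have hprob : IsProbabilityMeasure μ := ⟨by simp [hμ]⟩
  set p : ℝ := 1 / (q - 1) with hp
  have hppos : 0 < p := by positivity
  have hexp : 1 - q / (q - 1) = -p := by rw [hp]; field_simp; ring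
  rw [hexp]
  have hle : ∀ᵐ x ∂μ, w x ≤ ENNReal.ofReal x₂ := hsup ▸ ENNReal.ae_le_essSup w
  have hfin : ∀ᵐ x ∂μ, ENNReal.ofReal (w x).toReal = w x := hle.mono fun x hx =>
    ENNReal.ofReal_toReal (ne_top_of_le_ne_top ENNReal.ofReal_ne_top hx)
  have hWmeas : Measurable fun x => (w x).toReal := hw.1.ennreal_toReal
  have hWM : ∀ᵐ x ∂μ, (w x).toReal ≤ x₂ := hle.mono fun x hx =>
    ENNReal.toReal_le_of_le_ofReal hx2.le hx
  have hWint : ∫ x, (w x).toReal ∂μ = x₁ := by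
    rw [integral_toReal hw.1.aemeasurable
      (hle.mono fun x hx => hx.trans_lt ENNReal.ofReal_lt_top), havg, ENNReal.toReal_ofReal hx1.le]
  have hlevel : ∀ l, 0 < l → l < x₂ → ENNReal.ofReal l * μ {x | (w x).toReal < l} ≤
      ENNReal.ofReal δ * ∫⁻ x in {x | (w x).toReal < l}, ENNReal.ofReal (w x).toReal ∂μ := by
    intro l hl0 hl
    have hset : {x | (w x).toReal < l} =ᵐ[μ] {x | w x < ENNReal.ofReal l} := by
      filter_upwards [hfin] with x hx
      refine propext ?_
      change (w x).toReal < l ↔ w x < ENNReal.ofReal l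
      rw [← hx, ENNReal.ofReal_lt_ofReal_iff hl0, hx]
    rw [measure_congr hset, setLIntegral_congr hset, lintegral_congr_ae (ae_restrict_of_ae hfin)]
    exact hw.mul_volume_lt_le (by rwa [hsup, ENNReal.ofReal_lt_ofReal_iff hx2])
  have hbound : ∀ ε, 0 < ε → ε < x₂ → ∫⁻ x, (max (ENNReal.ofReal ε) (w x)) ^ (-p) ∂μ ≤
      ENNReal.ofReal (x₂ ^ (-p) * (q - δ * x₁ / x₂) / (q - δ)) := by
    intro ε hε hεM
    have hm : ∀ x, 0 < max ε (w x).toReal := fun x => lt_of_lt_of_le hε (le_max_left _ _)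
    have hreal := integral_max_rpow_le hWmeas hppos (by linarith) hε hεM
      (Filter.Eventually.of_forall fun x => ENNReal.toReal_nonneg) hWM hlevel
    have hcongr : ∫⁻ x, (max (ENNReal.ofReal ε) (w x)) ^ (-p) ∂μ =
        ∫⁻ x, ENNReal.ofReal ((max ε (w x).toReal) ^ (-p)) ∂μ := by
      refine lintegral_congr_ae ?_
      filter_upwards [hfin] with x hx
      rw [← ENNReal.ofReal_rpow_of_pos (hm x), ENNReal.ofReal_max, hx]
    have hinteg : Integrable (fun x => (max ε (w x).toReal) ^ (-p)) μ :=
      Integrable.of_bound ((measurable_const.max hWmeas).pow_const _).aestronglyMeasurable (ε ^ (-p)) (Filter.Eventually.of_forall fun x => by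
        rw [Real.norm_of_nonneg (Real.rpow_nonneg (hm x).le _)]
        exact Real.rpow_le_rpow_of_nonpos hε (le_max_left _ _) (by linarith))
    rw [hcongr, ← ofReal_integral_eq_lintegral_ofReal hinteg
      (Filter.Eventually.of_forall fun x => Real.rpow_nonneg (hm x).le _)]
    refine ENNReal.ofReal_le_ofReal ?_
    rw [hWint] at hreal
    generalize (∫ x, (max ε (w x).toReal) ^ (-p) ∂μ) = A at *
    have hp' : p + 1 = q / (q - 1) := by rw [hp]; field_simp; ring
    have hq0 : 0 < q := by linarith
    rw [Real.rpow_sub_one hx2.ne', hp', hp] at hreal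
    rw [le_div_iff₀ (by linarith)]
    have hk : 0 < q / (q - 1) := by positivity
    generalize x₂ ^ (-(1 / (q - 1))) = N at *
    have e1 : A * (q - δ) = (A * (1 / (1 / (q - 1)) - δ / (q / (q - 1)))) * (q / (q - 1)) := by
      field_simp
    have e2 : N * (q - δ * x₁ / x₂) =
        (N / (1 / (q - 1)) - δ / (q / (q - 1)) * (N / x₂) * x₁) * (q / (q - 1)) := by
      field_simp
    rw [e1, e2]
    exact mul_le_mul_of_nonneg_right hreal hk.le
  set e : ℕ → ℝ := fun n => x₂ / (n + 2) with he
  have hlim0 : Filter.Tendsto e Filter.atTop (nhds 0) :=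
    tendsto_const_nhds.div_atTop
      (Filter.tendsto_atTop_add_const_right _ _ tendsto_natCast_atTop_atTop)
  have hlim : ∀ x, Filter.Tendsto (fun n => (max (ENNReal.ofReal (e n)) (w x)) ^ (-p))
      Filter.atTop (nhds (w x ^ (-p))) := by
    intro x
    have h1 := (ENNReal.tendsto_ofReal hlim0).max (tendsto_const_nhds (x := w x))
    rw [ENNReal.ofReal_zero, max_eq_right zero_le] at h1
    exact (ENNReal.continuous_rpow_const.tendsto _).comp h1
  calc ∫⁻ x, w x ^ (-p) ∂μ
      = ∫⁻ x, Filter.liminf (fun n => (max (ENNReal.ofReal (e n)) (w x)) ^ (-p))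
          Filter.atTop ∂μ := by simp_rw [(hlim _).liminf_eq]
    _ ≤ Filter.liminf (fun n => ∫⁻ x, (max (ENNReal.ofReal (e n)) (w x)) ^ (-p) ∂μ)
          Filter.atTop :=
        lintegral_liminf_le fun n => (measurable_const.max hw.1).pow_const _
    _ ≤ _ := by
        refine Filter.liminf_le_of_le (by isBoundedDefault) fun b hb => ?_
        obtain ⟨n, hn⟩ := hb.exists
        refine hn.trans (hbound _ (by positivity) ?_)
        rw [he]
        exact div_lt_self hx2 (by linarith [(Nat.cast_nonneg n : (0 : ℝ) ≤ n)])

theorem setLIntegral_min_div_rpow {a r : ℝ} (ha : 0 < a) (ha1 : a ≤ 1) (hr : -1 < r) :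
    ∫⁻ t in Ioo (0 : ℝ) 1, ENNReal.ofReal ((min (t / a) 1) ^ r) =
      ENNReal.ofReal (a / (r + 1) + (1 - a)) := by
  have e1 : EqOn (fun t : ℝ => t ^ r / a ^ r) (fun t => (min (t / a) 1) ^ r) (Ioc 0 a) := by
    intro t ht
    simp only
    rw [min_eq_left ((div_le_one ha).2 ht.2), Real.div_rpow ht.1.le ha.le]
  have e2 : EqOn (fun _ : ℝ => (1 : ℝ)) (fun t => (min (t / a) 1) ^ r) (Ioc a 1) := by
    intro t ht
    simp only
    rw [min_eq_right ((one_le_div ha).2 ht.1.le), Real.one_rpow]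
  have i1 : IntervalIntegrable (fun t : ℝ => (min (t / a) 1) ^ r) volume 0 a :=
    ((intervalIntegral.intervalIntegrable_rpow' hr).div_const _).congr
      (by rwa [uIoc_of_le ha.le])
  have i2 : IntervalIntegrable (fun t : ℝ => (min (t / a) 1) ^ r) volume a 1 :=
    (intervalIntegrable_const (c := (1 : ℝ))).congr (by rwa [uIoc_of_le ha1])
  have v1 : ∫ t in (0 : ℝ)..a, (min (t / a) 1) ^ r = a / (r + 1) := by
    have hr1 : r + 1 ≠ 0 := by linarith
    rw [intervalIntegral.integral_of_le ha.le, ← setIntegral_congr_fun measurableSet_Ioc e1,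
      ← intervalIntegral.integral_of_le ha.le,
      intervalIntegral.integral_div, integral_rpow (Or.inl hr), Real.zero_rpow hr1,
      Real.rpow_add_one ha.ne']
    have := (Real.rpow_pos_of_pos ha r).ne'
    field_simp
    ring
  have v2 : ∫ t in a..(1 : ℝ), (min (t / a) 1) ^ r = 1 - a := by
    rw [intervalIntegral.integral_of_le ha1, ← setIntegral_congr_fun measurableSet_Ioc e2,
      ← intervalIntegral.integral_of_le ha1]
    simp
  rw [Measure.restrict_congr_set Ioo_ae_eq_Ioc, ← ofReal_integral_eq_lintegral_ofReal,
    ← intervalIntegral.integral_of_le zero_le_one,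
    ← intervalIntegral.integral_add_adjacent_intervals i1 i2, v1, v2]
  · exact (intervalIntegrable_iff_integrableOn_Ioc_of_le zero_le_one).1 (i1.trans i2)
  · filter_upwards [ae_restrict_mem measurableSet_Ioc] with t ht
    exact Real.rpow_nonneg (le_min (div_pos ht.1 ha).le zero_le_one) _

theorem le_setLIntegral_min_div_rpow {a δ c d : ℝ} (hδ : 1 < δ) (ha : 0 < a) (hc : 0 ≤ c)
    (hcd : c < d) :
    ENNReal.ofReal ((min (d / a) 1) ^ (δ - 1) * (d - c)) ≤
      ENNReal.ofReal δ * ∫⁻ t in Ioo c d, ENNReal.ofReal ((min (t / a) 1) ^ (δ - 1)) := by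
  have hd : 0 < d := hc.trans_lt hcd
  have hδ0 : 0 < δ := by linarith
  set N : ℝ := (min (d / a) 1) ^ (δ - 1) with hN
  have hN0 : 0 ≤ N := Real.rpow_nonneg (le_min (div_pos hd ha).le zero_le_one) _
  have hpt : ∀ t ∈ Ioo c d, N * (t / d) ^ (δ - 1) ≤ (min (t / a) 1) ^ (δ - 1) := by
    intro t ht
    have ht0 : 0 < t := hc.trans_lt ht.1
    rw [hN, ← Real.mul_rpow (le_min (div_pos hd ha).le zero_le_one) (div_pos ht0 hd).le]
    refine Real.rpow_le_rpow (mul_nonneg (le_min (div_pos hd ha).le zero_le_one)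
      (div_pos ht0 hd).le) (le_min ?_ ?_) (by linarith)
    · calc min (d / a) 1 * (t / d) ≤ d / a * (t / d) := by gcongr; exact min_le_left _ _
        _ = t / a := by field_simp
    · calc min (d / a) 1 * (t / d) ≤ 1 * 1 := by
            gcongr
            exacts [min_le_right _ _, (div_le_one hd).2 ht.2.le]
        _ = 1 := one_mul 1
  have hcont : Continuous fun t : ℝ => N * (t / d) ^ (δ - 1) :=
    continuous_const.mul ((Real.continuous_rpow_const (by linarith)).comp
      (continuous_id.div_const d))
  have hval : ∫⁻ t in Ioo c d, ENNReal.ofReal (N * (t / d) ^ (δ - 1)) =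
      ENNReal.ofReal (N * (d * ((1 - (c / d) ^ δ) / δ))) := by
    rw [Measure.restrict_congr_set Ioo_ae_eq_Ioc, ← ofReal_integral_eq_lintegral_ofReal,
      ← intervalIntegral.integral_of_le hcd.le, intervalIntegral.integral_const_mul,
      intervalIntegral.integral_comp_div (fun t => t ^ (δ - 1)) hd.ne',
      integral_rpow (Or.inl (by linarith)), div_self hd.ne']
    · simp
    · exact (hcont.intervalIntegrable c d).1
    · filter_upwards [ae_restrict_mem measurableSet_Ioc] with t ht
      exact mul_nonneg hN0 (Real.rpow_nonneg (div_nonneg (hc.trans ht.1.le) hd.le) _)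
  calc ENNReal.ofReal (N * (d - c))
      ≤ ENNReal.ofReal (δ * (N * (d * ((1 - (c / d) ^ δ) / δ)))) := by
        refine ENNReal.ofReal_le_ofReal ?_
        have h1 : (c / d) ^ δ ≤ c / d :=
          Real.rpow_le_self_of_le_one (div_nonneg hc hd.le) ((div_le_one hd).2 hcd.le) hδ.le
        have h2 : δ * (N * (d * ((1 - (c / d) ^ δ) / δ))) = N * (d * (1 - (c / d) ^ δ)) := by
          field_simp
        have h3 : d - c = d * (1 - c / d) := by field_simp
        rw [h2, h3]
        gcongr
    _ = ENNReal.ofReal δ * ∫⁻ t in Ioo c d, ENNReal.ofReal (N * (t / d) ^ (δ - 1)) := by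
        rw [hval, ENNReal.ofReal_mul hδ0.le]
    _ ≤ _ := by
        refine mul_le_mul' le_rfl (setLIntegral_mono' measurableSet_Ioo fun t ht => ?_)
        exact ENNReal.ofReal_le_ofReal (hpt t ht)

/-- The weight which is a power on `(0, a)` and constant on `(a, 1)`. -/
noncomputable def powerCutoffWeight (δ a M : ℝ) (t : ℝ) : ℝ≥0∞ :=
  ENNReal.ofReal M * ENNReal.ofReal ((min (t / a) 1) ^ (δ - 1))

theorem measurable_powerCutoffWeight (δ a M : ℝ) : Measurable (powerCutoffWeight δ a M) := by
  unfold powerCutoffWeight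
  fun_prop

theorem powerCutoffWeight_le {δ a M s t : ℝ} (hδ : 1 < δ) (ha : 0 < a) (hs : 0 ≤ s)
    (hst : s ≤ t) : powerCutoffWeight δ a M s ≤ powerCutoffWeight δ a M t := by
  unfold powerCutoffWeight
  have : 0 ≤ min (s / a) 1 := le_min (div_nonneg hs ha.le) zero_le_one
  gcongr

theorem essSup_powerCutoffWeight_le {δ a M c d : ℝ} (hδ : 1 < δ) (ha : 0 < a) (hc : 0 ≤ c) :
    essSup (powerCutoffWeight δ a M) (volume.restrict (Ioo c d)) ≤ powerCutoffWeight δ a M d := by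
  refine essSup_le_of_ae_le _ ?_
  filter_upwards [ae_restrict_mem measurableSet_Ioo] with t ht
  exact powerCutoffWeight_le hδ ha (hc.trans ht.1.le) ht.2.le

theorem powerCutoffWeight_one {δ a M : ℝ} (ha : 0 < a) (ha1 : a ≤ 1) :
    powerCutoffWeight δ a M 1 = ENNReal.ofReal M := by
  rw [powerCutoffWeight, min_eq_right ((one_le_div ha).2 ha1), Real.one_rpow, ENNReal.ofReal_one,
    mul_one]

theorem essSup_powerCutoffWeight {δ a M : ℝ} (hδ : 1 < δ) (ha : 0 < a) (ha1 : a ≤ 1) :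
    essSup (powerCutoffWeight δ a M) (volume.restrict (Ioo (0 : ℝ) 1)) = ENNReal.ofReal M := by
  refine le_antisymm ?_ ?_
  · rw [← powerCutoffWeight_one (δ := δ) (M := M) ha ha1]
    exact essSup_powerCutoffWeight_le hδ ha le_rfl
  · have hcont : Continuous (powerCutoffWeight δ a M) := by
      have : Continuous fun t : ℝ => (min (t / a) 1) ^ (δ - 1) :=
        (Real.continuous_rpow_const (by linarith)).comp
          ((continuous_id.div_const a).min continuous_const)
      exact ENNReal.continuous_const_mul ENNReal.ofReal_ne_top |>.comp
        (ENNReal.continuous_ofReal.comp this)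
    rw [← powerCutoffWeight_one (δ := δ) (M := M) ha ha1]
    refine le_of_tendsto ((hcont.tendsto 1).mono_left
      (nhdsWithin_le_nhds (s := Iio 1))) ?_
    filter_upwards [Ioo_mem_nhdsLT (zero_lt_one' ℝ)] with t ht
    have hsub : Ioo t 1 ⊆ Ioo (0 : ℝ) 1 := Ioo_subset_Ioo_left ht.1.le
    have hne : (ae (volume.restrict (Ioo t 1))).NeBot := by
      rw [ae_neBot, Ne, Measure.restrict_eq_zero]
      simpa using ht.2
    obtain ⟨s, hs, hs'⟩ := ((ae_restrict_mem (μ := volume) (measurableSet_Ioo (a := t) (b := 1))).and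
      (ae_restrict_of_ae_restrict_of_subset hsub
        (ENNReal.ae_le_essSup (powerCutoffWeight δ a M)))).exists
    exact (powerCutoffWeight_le hδ ha ht.1.le hs.1.le).trans hs'

theorem setLIntegral_powerCutoffWeight {δ a M : ℝ} (hδ : 1 < δ) (hM : 0 ≤ M) (ha : 0 < a)
    (ha1 : a ≤ 1) :
    ∫⁻ t in Ioo (0 : ℝ) 1, powerCutoffWeight δ a M t =
      ENNReal.ofReal (M * (a / δ + (1 - a))) := by
  unfold powerCutoffWeight
  rw [lintegral_const_mul _ (by fun_prop), setLIntegral_min_div_rpow ha ha1 (by linarith),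
    ENNReal.ofReal_mul hM, sub_add_cancel]

theorem memRHinf_powerCutoffWeight {δ a M : ℝ} (hδ : 1 < δ) (hM : 0 ≤ M) (ha : 0 < a)
    (ha1 : a ≤ 1) : MemRHinf δ 0 1 (powerCutoffWeight δ a M) := by
  refine ⟨measurable_powerCutoffWeight δ a M, ?_, fun c d hc hcd _ => ?_⟩
  · rw [setLIntegral_powerCutoffWeight hδ hM ha ha1]
    exact ENNReal.ofReal_ne_top
  · refine (essSup_powerCutoffWeight_le hδ ha hc).trans ?_
    have hpos : 0 < d - c := sub_pos.2 hcd
    have h := le_setLIntegral_min_div_rpow hδ ha hc hcd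
    rw [avgE, ← mul_div_assoc, ENNReal.le_div_iff_mul_le (Or.inl (by simpa using hpos))
      (Or.inl ENNReal.ofReal_ne_top)]
    unfold powerCutoffWeight
    rw [lintegral_const_mul _ (by fun_prop), mul_assoc, ← ENNReal.ofReal_mul' hpos.le,
      mul_left_comm]
    exact mul_le_mul' le_rfl h

theorem setLIntegral_powerCutoffWeight_rpow {δ a M p : ℝ} (hM : 0 < M)
    (ha : 0 < a) (ha1 : a ≤ 1) (hp : p * (δ - 1) < 1) :
    ∫⁻ t in Ioo (0 : ℝ) 1, powerCutoffWeight δ a M t ^ (-p) =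
      ENNReal.ofReal (M ^ (-p) * (a / (1 - p * (δ - 1)) + (1 - a))) := by
  have hcongr : ∀ t ∈ Ioo (0 : ℝ) 1, powerCutoffWeight δ a M t ^ (-p) =
      ENNReal.ofReal (M ^ (-p)) * ENNReal.ofReal ((min (t / a) 1) ^ (-(p * (δ - 1)))) := by
    intro t ht
    have hm : 0 < min (t / a) 1 := lt_min (div_pos ht.1 ha) one_pos
    have hm' := Real.rpow_pos_of_pos hm (δ - 1)
    rw [powerCutoffWeight, ← ENNReal.ofReal_mul hM.le, ENNReal.ofReal_rpow_of_pos (by positivity),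
      Real.mul_rpow hM.le hm'.le, ← Real.rpow_mul hm.le,
      ENNReal.ofReal_mul (Real.rpow_nonneg hM.le _)]
    congr 4
    ring
  rw [setLIntegral_congr_fun measurableSet_Ioo hcongr, lintegral_const_mul _ (by fun_prop),
    setLIntegral_min_div_rpow ha ha1 (by linarith), ENNReal.ofReal_mul (Real.rpow_nonneg hM.le _),
    neg_add_eq_sub]

theorem statement11 (δ q x₁ x₂ : ℝ) (hδ : 1 < δ) (hq : δ < q)
    (hx1 : 0 < x₁) (h12 : x₁ < x₂) (h2 : x₂ ≤ δ * x₁) :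
    sSup { y : ℝ≥0∞ | ∃ w : ℝ → ℝ≥0∞, MemRHinf δ 0 1 w ∧
        avgE w 0 1 = ENNReal.ofReal x₁ ∧
        essSup w (volume.restrict (Set.Ioo (0:ℝ) 1)) = ENNReal.ofReal x₂ ∧
        y = avgE (fun t => w t ^ (1 - q / (q - 1))) 0 1 }
      = ENNReal.ofReal (x₂ ^ (1 - q / (q - 1)) * (q - δ * x₁ / x₂) / (q - δ)) := by
  have hx2 : 0 < x₂ := hx1.trans h12
  have hδ1 : 0 < δ - 1 := by linarith
  have hq1 : 0 < q - 1 := by linarith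
  have hqδ : 0 < q - δ := by linarith
  refine le_antisymm ?_ (le_sSup ?_)
  · refine sSup_le ?_
    rintro _ ⟨w, hw, havg, hsup, rfl⟩
    exact hw.avgE_rpow_le hδ hq hx1 h12 havg hsup
  · set a : ℝ := (1 - x₁ / x₂) * δ / (δ - 1) with ha_def
    have hr : x₁ / x₂ < 1 := (div_lt_one hx2).2 h12
    have ha : 0 < a := div_pos (mul_pos (by linarith) (by linarith)) hδ1
    have ha1 : a ≤ 1 := by
      rw [ha_def, div_le_one hδ1]
      have : 1 ≤ δ * (x₁ / x₂) := by rwa [← mul_div_assoc, one_le_div hx2]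
      linarith
    refine ⟨powerCutoffWeight δ a x₂, memRHinf_powerCutoffWeight hδ hx2.le ha ha1, ?_,
      essSup_powerCutoffWeight hδ ha ha1, ?_⟩
    · rw [avgE_zero_one, setLIntegral_powerCutoffWeight hδ hx2.le ha ha1, ha_def]
      congr 1
      field_simp
      ring
    · have hexp : 1 - q / (q - 1) = -(1 / (q - 1)) := by field_simp; ring
      have hp : 1 / (q - 1) * (δ - 1) < 1 := by
        rw [one_div_mul_eq_div, div_lt_one hq1]; linarith
      rw [avgE_zero_one, hexp, setLIntegral_powerCutoffWeight_rpow hx2 ha ha1 hp, mul_div_assoc]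
      congr 2
      have e : 1 - 1 / (q - 1) * (δ - 1) = (q - δ) / (q - 1) := by field_simp; ring
      rw [e, ha_def]
      field_simp
      ring
end

section
/- Let δ > 1, 1 < q ≤ δ, and let I = [0,1]. For every point (x₁, x₂) with x₁ < x₂ ≤ δ x₁, one has sup{ ⟨w^{1−q'}⟩_I : w ∈ RH_∞^δ(I), ⟨w⟩_I = x₁, ess sup_I w = x₂ } = ∞; that is, there exists a weight w ∈ RH_∞^δ(I) with ⟨w⟩_I = x₁ and ess sup_I w = x₂ for which ∫_0^1 w^{1−q'} = ∞. -/
open MeasureTheory Set ENNReal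

/-- The integral of `1 / t` diverges at the origin. -/
theorem lintegral_ofReal_inv_Ioo_zero {s : ℝ} (hs : 0 < s) :
    ∫⁻ t in Set.Ioo 0 s, ENNReal.ofReal t⁻¹ = ⊤ := by
  by_contra h
  have hint : IntegrableOn (fun t : ℝ => t⁻¹) (Set.Ioo 0 s) := by
    refine ⟨by fun_prop, ?_⟩
    rw [hasFiniteIntegral_iff_ofReal]
    · exact lt_top_iff_ne_top.2 h
    · filter_upwards [ae_restrict_mem measurableSet_Ioo] with t ht
      exact inv_nonneg.2 ht.1.le
  have h2 : IntervalIntegrable (fun t : ℝ => t⁻¹) volume 0 s := by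
    rwa [intervalIntegrable_iff_integrableOn_Ioo_of_le hs.le]
  rw [intervalIntegrable_inv_iff] at h2
  rcases h2 with h2 | h2
  · exact hs.ne h2
  · exact h2 Set.left_mem_uIcc

/-- A function which grows at the origin like the power `p`, truncated at the point `s`. -/
noncomputable def truncPow (c s p t : ℝ) : ℝ := c * min (t / s) 1 ^ p

section truncPow

variable {c s p : ℝ}

theorem continuous_truncPow (hp : 0 < p) : Continuous (truncPow c s p) := by
  unfold truncPow
  exact continuous_const.mul
    (((continuous_id.div_const s).min continuous_const).rpow_const fun _ => Or.inr hp.le)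

theorem truncPow_pos (hc : 0 < c) (hs : 0 < s) {t : ℝ} (ht : 0 < t) : 0 < truncPow c s p t :=
  mul_pos hc (Real.rpow_pos_of_pos (lt_min (div_pos ht hs) one_pos) _)

theorem truncPow_nonneg (hc : 0 < c) (hs : 0 < s) {t : ℝ} (ht : 0 ≤ t) :
    0 ≤ truncPow c s p t :=
  mul_nonneg hc.le (Real.rpow_nonneg (le_min (div_nonneg ht hs.le) zero_le_one) _)

theorem truncPow_mono (hc : 0 < c) (hs : 0 < s) (hp : 0 < p) {t b : ℝ} (ht : 0 ≤ t)
    (htb : t ≤ b) : truncPow c s p t ≤ truncPow c s p b := by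
  have h0 : 0 ≤ min (t / s) 1 := le_min (div_nonneg ht hs.le) zero_le_one
  unfold truncPow
  gcongr

theorem truncPow_of_le (hs : 0 < s) {t : ℝ} (ht : t ≤ s) :
    truncPow c s p t = c * (t / s) ^ p := by
  rw [truncPow, min_eq_left ((div_le_one hs).2 ht)]

theorem truncPow_of_ge (hs : 0 < s) {t : ℝ} (ht : s ≤ t) : truncPow c s p t = c := by
  rw [truncPow, min_eq_right ((one_le_div hs).2 ht), Real.one_rpow, mul_one]

theorem mul_div_rpow_le_truncPow (hc : 0 < c) (hs : 0 < s) (hp : 0 < p) {t b : ℝ} (ht : 0 ≤ t)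
    (hb : 0 < b) (htb : t ≤ b) : truncPow c s p b * (t / b) ^ p ≤ truncPow c s p t := by
  have h0 : 0 ≤ min (b / s) 1 := le_min (div_nonneg hb.le hs.le) zero_le_one
  have h1 : 0 ≤ t / b := div_nonneg ht hb.le
  have h2 : t / b ≤ 1 := (div_le_one hb).2 htb
  unfold truncPow
  rw [mul_assoc, ← Real.mul_rpow h0 h1]
  refine mul_le_mul_of_nonneg_left (Real.rpow_le_rpow (mul_nonneg h0 h1) ?_ hp.le) hc.le
  refine le_min ?_ (mul_le_one₀ (min_le_right _ _) h1 h2)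
  calc min (b / s) 1 * (t / b) ≤ b / s * (t / b) := by gcongr; exact min_le_left _ _
    _ = t / s := by field_simp

theorem lintegral_ofReal_truncPow (hc : 0 < c) (hs : 0 < s) (hp : 0 < p) {a b : ℝ} (ha : 0 ≤ a)
    (hab : a ≤ b) : ∫⁻ t in Set.Ioo a b, ENNReal.ofReal (truncPow c s p t) =
      ENNReal.ofReal (∫ t in a..b, truncPow c s p t) := by
  have hi := (continuous_truncPow (c := c) (s := s) hp).intervalIntegrable (μ := volume) a b
  rw [intervalIntegral.integral_of_le hab, integral_Ioc_eq_integral_Ioo,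
    ofReal_integral_eq_lintegral_ofReal]
  · exact (intervalIntegrable_iff_integrableOn_Ioo_of_le hab).1 hi
  · filter_upwards [ae_restrict_mem measurableSet_Ioo] with t ht
    exact truncPow_nonneg hc hs (ha.trans ht.1.le)

theorem integral_div_rpow (hp : 0 < p) {a b d : ℝ} (ha : 0 ≤ a) (hab : a ≤ b) (hd : 0 < d) :
    ∫ t in a..b, (t / d) ^ p = (b * (b / d) ^ p - a * (a / d) ^ p) / (p + 1) := by
  have key (x : ℝ) (hx : 0 ≤ x) : (x / d) ^ (p + 1) * d = x * (x / d) ^ p := by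
    rw [Real.rpow_add_one' (div_nonneg hx hd.le) (by positivity)]
    field_simp
  rw [intervalIntegral.integral_comp_div (fun x => x ^ p) hd.ne',
    integral_rpow (Or.inl (by linarith)), smul_eq_mul, ← key a ha, ← key b (ha.trans hab)]
  ring

theorem sub_mul_truncPow_le_integral (hc : 0 < c) (hs : 0 < s) (hp : 0 < p) {a b : ℝ}
    (ha : 0 ≤ a) (hab : a < b) :
    (b - a) * truncPow c s p b ≤ (p + 1) * ∫ t in a..b, truncPow c s p t := by
  have hb : 0 < b := ha.trans_lt hab
  have hint : ∫ t in a..b, truncPow c s p b * (t / b) ^ p ≤ ∫ t in a..b, truncPow c s p t := by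
    refine intervalIntegral.integral_mono_on hab.le (Continuous.intervalIntegrable ?_ _ _)
      ((continuous_truncPow hp).intervalIntegrable _ _) fun t ht =>
        mul_div_rpow_le_truncPow hc hs hp (ha.trans ht.1) hb ht.2
    exact continuous_const.mul ((continuous_id.div_const b).rpow_const fun _ => Or.inr hp.le)
  rw [intervalIntegral.integral_const_mul, integral_div_rpow hp ha hab.le hb, div_self hb.ne',
    Real.one_rpow] at hint
  have h1 : (a / b) ^ p ≤ 1 :=
    Real.rpow_le_one (div_nonneg ha hb.le) ((div_le_one hb).2 hab.le) hp.le
  have hp1 : 0 < p + 1 := by linarith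
  calc (b - a) * truncPow c s p b ≤ (b * 1 - a * (a / b) ^ p) * truncPow c s p b := by
        refine mul_le_mul_of_nonneg_right ?_ (truncPow_pos hc hs hb).le
        nlinarith
    _ = (p + 1) * (truncPow c s p b * ((b * 1 - a * (a / b) ^ p) / (p + 1))) := by field_simp
    _ ≤ _ := mul_le_mul_of_nonneg_left hint hp1.le

theorem memRHinf_truncPow (hc : 0 < c) (hs : 0 < s) (hp : 0 < p) :
    MemRHinf (p + 1) 0 1 fun t => ENNReal.ofReal (truncPow c s p t) := by
  refine ⟨(continuous_truncPow hp).measurable.ennreal_ofReal, ?_, fun a b ha hab _ => ?_⟩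
  · rw [lintegral_ofReal_truncPow hc hs hp le_rfl zero_le_one]
    exact ENNReal.ofReal_ne_top
  · have hba : 0 < b - a := sub_pos.2 hab
    refine (essSup_le_of_ae_le (ENNReal.ofReal (truncPow c s p b)) ?_).trans ?_
    · filter_upwards [ae_restrict_mem measurableSet_Ioo] with t ht
      exact ENNReal.ofReal_le_ofReal (truncPow_mono hc hs hp (ha.trans ht.1.le) ht.2.le)
    · rw [avgE, lintegral_ofReal_truncPow hc hs hp ha hab.le, ← ENNReal.ofReal_div_of_pos hba,
        ← ENNReal.ofReal_mul (by linarith)]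
      apply ENNReal.ofReal_le_ofReal
      rw [← mul_div_assoc, le_div_iff₀ hba, mul_comm]
      exact sub_mul_truncPow_le_integral hc hs hp ha hab

theorem avgE_truncPow (hc : 0 < c) (hs : 0 < s) (hs1 : s ≤ 1) (hp : 0 < p) :
    avgE (fun t => ENNReal.ofReal (truncPow c s p t)) 0 1 =
      ENNReal.ofReal (c * (1 - s * p / (p + 1))) := by
  have hi (a b : ℝ) : IntervalIntegrable (truncPow c s p) volume a b :=
    (continuous_truncPow hp).intervalIntegrable a b
  have h1 : ∫ t in (0 : ℝ)..s, truncPow c s p t = c * (s / (p + 1)) := by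
    rw [intervalIntegral.integral_congr (g := fun t => c * (t / s) ^ p),
      intervalIntegral.integral_const_mul, integral_div_rpow hp le_rfl hs.le hs]
    · simp [hs.ne']
    · intro t ht
      rw [Set.uIcc_of_le hs.le] at ht
      exact truncPow_of_le hs ht.2
  have h2 : ∫ t in s..1, truncPow c s p t = (1 - s) * c := by
    rw [intervalIntegral.integral_congr (g := fun _ => c)]
    · simp
    · intro t ht
      rw [Set.uIcc_of_le hs1] at ht
      exact truncPow_of_ge hs ht.1
  rw [avgE, lintegral_ofReal_truncPow hc hs hp le_rfl zero_le_one,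
    ← intervalIntegral.integral_add_adjacent_intervals (hi 0 s) (hi s 1), h1, h2]
  simp only [sub_zero, ENNReal.ofReal_one, div_one]
  congr 1
  have hp1 : p + 1 ≠ 0 := by linarith
  field_simp
  ring

theorem essSup_truncPow (hc : 0 < c) (hs : 0 < s) (hs1 : s ≤ 1) (hp : 0 < p) :
    essSup (fun t => ENNReal.ofReal (truncPow c s p t)) (volume.restrict (Set.Ioo (0 : ℝ) 1)) =
      ENNReal.ofReal c := by
  have hone : truncPow c s p 1 = c := truncPow_of_ge hs hs1
  refine le_antisymm (essSup_le_of_ae_le _ ?_) ?_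
  · filter_upwards [ae_restrict_mem measurableSet_Ioo] with t ht
    exact ENNReal.ofReal_le_ofReal ((truncPow_mono hc hs hp ht.1.le ht.2.le).trans_eq hone)
  · have hcont : Continuous fun t => ENNReal.ofReal (truncPow c s p t) :=
      ENNReal.continuous_ofReal.comp (continuous_truncPow hp)
    have ht := (hcont.tendsto 1).mono_left (nhdsWithin_le_nhds (s := Set.Iio 1))
    rw [hone] at ht
    refine le_of_tendsto ht ?_
    filter_upwards [Ioo_mem_nhdsLT (zero_lt_one' ℝ)] with d hd
    have hne : volume.restrict (Set.Ioo d 1) ≠ 0 := by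
      simp [Measure.restrict_eq_zero, hd.2]
    rw [← essSup_const (ENNReal.ofReal (truncPow c s p d)) hne]
    refine (essSup_mono_ae ?_).trans (essSup_mono_measure' (Measure.restrict_mono
      (Set.Ioo_subset_Ioo_left hd.1.le) le_rfl))
    filter_upwards [ae_restrict_mem measurableSet_Ioo] with t ht
    exact ENNReal.ofReal_le_ofReal (truncPow_mono hc hs hp hd.1.le ht.1.le)

theorem lintegral_truncPow_rpow_neg (hc : 0 < c) (hs : 0 < s) (hs1 : s ≤ 1) {r : ℝ}
    (hpr : 1 ≤ p * r) :
    ∫⁻ t in Set.Ioo (0 : ℝ) 1, ENNReal.ofReal (truncPow c s p t) ^ (-r) = ⊤ := by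
  have hK : 0 < c ^ (-r) * s := mul_pos (Real.rpow_pos_of_pos hc _) hs
  rw [eq_top_iff]
  calc (⊤ : ℝ≥0∞) = ENNReal.ofReal (c ^ (-r) * s) *
        ∫⁻ t in Set.Ioo 0 s, ENNReal.ofReal t⁻¹ := by
        rw [lintegral_ofReal_inv_Ioo_zero hs, ENNReal.mul_top]
        simpa using hK
    _ = ∫⁻ t in Set.Ioo 0 s, ENNReal.ofReal (c ^ (-r) * s) * ENNReal.ofReal t⁻¹ := by
        rw [lintegral_const_mul' _ _ ENNReal.ofReal_ne_top]
    _ ≤ ∫⁻ t in Set.Ioo 0 s, ENNReal.ofReal (truncPow c s p t) ^ (-r) := by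
        refine setLIntegral_mono' measurableSet_Ioo fun t ht => ?_
        have hts : 0 < t / s := div_pos ht.1 hs
        rw [ENNReal.ofReal_rpow_of_pos (truncPow_pos hc hs ht.1), ← ENNReal.ofReal_mul hK.le,
          truncPow_of_le hs ht.2.le, Real.mul_rpow hc.le (Real.rpow_nonneg hts.le _),
          ← Real.rpow_mul hts.le, mul_assoc]
        refine ENNReal.ofReal_le_ofReal
          (mul_le_mul_of_nonneg_left ?_ (Real.rpow_nonneg hc.le _))
        calc s * t⁻¹ = (t / s) ^ (-1 : ℝ) := by
              rw [Real.rpow_neg_one, inv_div, div_eq_mul_inv]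
          _ ≤ (t / s) ^ (p * -r) :=
              Real.rpow_le_rpow_of_exponent_ge hts ((div_le_one hs).2 ht.2.le) (by linarith)
    _ ≤ _ := lintegral_mono_set (Set.Ioo_subset_Ioo_right hs1)

end truncPow

theorem statement12 (δ q x₁ x₂ : ℝ) (hδ : 1 < δ) (hq1 : 1 < q) (hq : q ≤ δ)
    (h12 : x₁ < x₂) (h2 : x₂ ≤ δ * x₁) :
    sSup { y : ℝ≥0∞ | ∃ w : ℝ → ℝ≥0∞, MemRHinf δ 0 1 w ∧
        avgE w 0 1 = ENNReal.ofReal x₁ ∧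
        essSup w (volume.restrict (Set.Ioo (0:ℝ) 1)) = ENNReal.ofReal x₂ ∧
        y = avgE (fun t => w t ^ (1 - q / (q - 1))) 0 1 } = ⊤ ∧
    ∃ w : ℝ → ℝ≥0∞, MemRHinf δ 0 1 w ∧
      avgE w 0 1 = ENNReal.ofReal x₁ ∧
      essSup w (volume.restrict (Set.Ioo (0:ℝ) 1)) = ENNReal.ofReal x₂ ∧
      (∫⁻ t in Set.Ioo (0:ℝ) 1, w t ^ (1 - q / (q - 1))) = ⊤ := by
  have hx₁ : 0 < x₁ := by nlinarith
  have hx₂ : 0 < x₂ := hx₁.trans h12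
  have hp : 0 < δ - 1 := sub_pos.2 hδ
  have hq0 : 0 < q - 1 := sub_pos.2 hq1
  have hexp : 1 - q / (q - 1) = -(1 / (q - 1)) := by field_simp; ring
  have hpr : 1 ≤ (δ - 1) * (1 / (q - 1)) := by
    rw [mul_one_div, one_le_div hq0]
    linarith
  obtain ⟨s, hs, hs1, hsx⟩ : ∃ s : ℝ, 0 < s ∧ s ≤ 1 ∧
      x₂ * (1 - s * (δ - 1) / (δ - 1 + 1)) = x₁ := by
    refine ⟨(x₂ - x₁) * δ / (x₂ * (δ - 1)), ?_, ?_, ?_⟩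
    · exact div_pos (mul_pos (sub_pos.2 h12) (by linarith)) (mul_pos hx₂ hp)
    · rw [div_le_one (mul_pos hx₂ hp)]
      linarith
    · have hδ0 : δ ≠ 0 := by linarith
      rw [sub_add_cancel]
      field_simp
      ring
  have hmem : MemRHinf δ 0 1 fun t => ENNReal.ofReal (truncPow x₂ s (δ - 1) t) := by
    simpa using memRHinf_truncPow hx₂ hs hp
  have havg := avgE_truncPow hx₂ hs hs1 hp
  rw [hsx] at havg
  have hsup := essSup_truncPow hx₂ hs hs1 hp
  have htop := lintegral_truncPow_rpow_neg hx₂ hs hs1 hpr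
  rw [← hexp] at htop
  refine ⟨top_le_iff.1 (le_sSup ⟨_, hmem, havg, hsup, ?_⟩), _, hmem, havg, hsup, htop⟩
  simp [avgE, htop]
end
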